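/- For the TSAW (X_n)_{n≥0} with parameter λ ∈ (0,1): for every k ∈ ℤ and m ≥ 0 the stopping time τ_{k,m} is almost surely finite, and for every j ∈ {0,1,…,m} the distribution of the number of right steps from k made before time τ_{k,m} is given by P( 𝓔⁺_{τ_{k,m}}(k) = j ) = P₁(𝔇_m = 2j − m + 1) if k ≤ −1, P( 𝓔⁺_{τ_{k,m}}(k) = j ) = P₀(𝔇̃_m = 2j − m) if k = 0, and P( 𝓔⁺_{τ_{k,m}}(k) = j ) = P₀(𝔇_m = 2j − m) if k ≥ 1. -/

import Mathlib

open MeasureTheory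

noncomputable section

/-- The local time of the sequence `X` at site `k` up to time `n` (inclusively). -/
def locTime (X : ℕ → ℤ) (n : ℕ) (k : ℤ) : ℕ :=
  ((Finset.range (n + 1)).filter fun i => X i = k).card

/-- The inverse local time `τ_{k,m}`: the time of the `(m+1)`-th visit of `X` to `k`. -/
def invLocTime (X : ℕ → ℤ) (k : ℤ) (m : ℕ) : ℕ :=
  sInf {n | m < locTime X n k}

/-- The directed edge local time `𝓔⁺_n(k)`: number of crossings of `k → k+1` before time `n`. -/
def edgePlus (X : ℕ → ℤ) (n : ℕ) (k : ℤ) : ℕ :=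
  ((Finset.range n).filter fun i => X i = k ∧ X (i + 1) = k + 1).card

/-- The directed edge local time `𝓔⁻_n(k)`: number of crossings of `k → k-1` before time `n`. -/
def edgeMinus (X : ℕ → ℤ) (n : ℕ) (k : ℤ) : ℕ :=
  ((Finset.range n).filter fun i => X i = k ∧ X (i + 1) = k - 1).card

/-- The conditional probability, for the TSAW with parameter `lam`, of the step from
`p i` to `p (i+1)` given the history `p 0, …, p i`. -/
def tsawStep (lam : ℝ) (p : ℕ → ℤ) (i : ℕ) : ℝ :=
  if p (i + 1) = p i + 1 then
    lam ^ (edgePlus p i (p i) + edgeMinus p i (p i + 1)) /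
      (lam ^ (edgePlus p i (p i) + edgeMinus p i (p i + 1)) +
        lam ^ (edgePlus p i (p i - 1) + edgeMinus p i (p i)))
  else if p (i + 1) = p i - 1 then
    lam ^ (edgePlus p i (p i - 1) + edgeMinus p i (p i)) /
      (lam ^ (edgePlus p i (p i) + edgeMinus p i (p i + 1)) +
        lam ^ (edgePlus p i (p i - 1) + edgeMinus p i (p i)))
  else 0

/-- `P` is the law of the "true" self-avoiding walk with parameter `lam`, started at the
origin, characterized by its cylinder probabilities. -/
def IsTSAW (lam : ℝ) (P : Measure (ℕ → ℤ)) : Prop :=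
  IsProbabilityMeasure P ∧
    ∀ (n : ℕ) (p : ℕ → ℤ),
      (P {ω | ∀ i ≤ n, ω i = p i}).toReal =
        (if p 0 = 0 then (1 : ℝ) else 0) * ∏ i ∈ Finset.range n, tsawStep lam p i

/-- One-step transition probability of the urn discrepancy chain with parameter `lam`. -/
def urnStep (lam : ℝ) (i j : ℤ) : ℝ :=
  if j = i + 1 then lam ^ (2 * i - 1) / (1 + lam ^ (2 * i - 1))
  else if j = i - 1 then 1 / (1 + lam ^ (2 * i - 1))
  else 0

/-- One-step transition probability of the modified urn discrepancy chain. -/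
def urnStepTilde (lam : ℝ) (i j : ℤ) : ℝ :=
  if j = i + 1 then lam ^ (2 * i) / (1 + lam ^ (2 * i))
  else if j = i - 1 then 1 / (1 + lam ^ (2 * i))
  else 0

/-- `P` is the family of laws (indexed by the starting point) of the urn discrepancy chain. -/
def IsUrnChain (lam : ℝ) (P : ℤ → Measure (ℕ → ℤ)) : Prop :=
  (∀ x, IsProbabilityMeasure (P x)) ∧
    ∀ (x : ℤ) (n : ℕ) (p : ℕ → ℤ),
      (P x {ω | ∀ i ≤ n, ω i = p i}).toReal =
        (if p 0 = x then (1 : ℝ) else 0) *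
          ∏ i ∈ Finset.range n, urnStep lam (p i) (p (i + 1))

/-- `P` is the family of laws of the modified urn discrepancy chain. -/
def IsUrnChainTilde (lam : ℝ) (P : ℤ → Measure (ℕ → ℤ)) : Prop :=
  (∀ x, IsProbabilityMeasure (P x)) ∧
    ∀ (x : ℤ) (n : ℕ) (p : ℕ → ℤ),
      (P x {ω | ∀ i ≤ n, ω i = p i}).toReal =
        (if p 0 = x then (1 : ℝ) else 0) *
          ∏ i ∈ Finset.range n, urnStepTilde lam (p i) (p (i + 1))

/-- Maximum principle for a one-sided recursion whose growth at `-∞` is at most linear. -/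
theorem nonneg_of_mul_pred_le {c k : ℤ → ℝ} (hc : ∀ w, 0 ≤ c w) (hc' : ∀ w ≤ 0, c w ≤ 1 / 2)
    (hk : ∀ w, c w * k (w - 1) ≤ k w) (C : ℝ) (hC0 : 0 ≤ C)
    (hC : ∀ w : ℤ, w ≤ 0 → -(C * (1 - w)) ≤ k w) (w : ℤ) : 0 ≤ k w := by
  have key : ∀ m : ℕ, ∀ w : ℤ, w ≤ 0 → -(C * ((1 / 2 : ℝ) ^ m * (1 - w + m))) ≤ k w := by
    intro m
    induction m with
    | zero => intro w hw; simpa using hC w hw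
    | succ m ih =>
      intro w hw
      have h1 := ih (w - 1) (by omega)
      have hw' : (w : ℝ) ≤ 0 := by exact_mod_cast hw
      refine le_trans ?_ (hk w)
      set A : ℝ := C * ((1 / 2 : ℝ) ^ m * (1 - ((w - 1 : ℤ) : ℝ) + m)) with hA
      have hA0 : 0 ≤ A := by
        have h2 : (0 : ℝ) ≤ 1 - ((w - 1 : ℤ) : ℝ) + m := by
          push_cast
          have : (0 : ℝ) ≤ m := Nat.cast_nonneg m
          linarith
        positivity
      have e : C * ((1 / 2 : ℝ) ^ (m + 1) * (1 - w + ((m + 1 : ℕ) : ℝ))) = 1 / 2 * A := by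
        rw [hA]; push_cast; ring
      rw [e]
      nlinarith [hc w, hc' w hw]
  have hneg : ∀ w : ℤ, w ≤ 0 → 0 ≤ k w := by
    intro w hw
    have h1 : Filter.Tendsto (fun m : ℕ => (1 / 2 : ℝ) ^ m) Filter.atTop (nhds 0) :=
      tendsto_pow_atTop_nhds_zero_of_lt_one (by norm_num) (by norm_num)
    have h2 : Filter.Tendsto (fun m : ℕ => (m : ℝ) * (1 / 2 : ℝ) ^ m) Filter.atTop (nhds 0) :=
      tendsto_self_mul_const_pow_of_lt_one (by norm_num) (by norm_num)
    have h3 := (((h1.mul_const (1 - (w : ℝ))).add h2).const_mul C).neg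
    refine le_of_tendsto' (x := Filter.atTop)
      (f := fun m : ℕ => -(C * ((1 / 2 : ℝ) ^ m * (1 - w + m)))) ?_ (fun m => key m w hw)
    convert h3 using 2
    · ring
    · simp
  rcases le_or_gt w 0 with hw | hw
  · exact hneg w hw
  · have := Int.leInduction (m := 0) (motive := fun w _ => 0 ≤ k w) (hneg 0 le_rfl)
      (fun n _ ih => by
        refine le_trans (mul_nonneg (hc (n + 1)) ?_) (hk (n + 1))
        simpa using ih) w hw.le
    exact this

/-- The probability, for the nearest-neighbour chain on `ℤ` with up-probabilities `pr` started
at `w`, that exactly `a` down-steps occur before the `n`-th up-step. -/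
def leftsLaw (pr : ℤ → ℝ) : ℕ → ℕ → ℤ → ℝ
  | 0, 0, _ => 1
  | 0, _ + 1, _ => 0
  | n + 1, 0, w => pr w * leftsLaw pr n 0 (w + 1)
  | n + 1, a + 1, w =>
      pr w * leftsLaw pr n (a + 1) (w + 1) + (1 - pr w) * leftsLaw pr (n + 1) a (w - 1)

theorem leftsLaw_nonneg {pr : ℤ → ℝ} (h0 : ∀ w, 0 ≤ pr w) (h1 : ∀ w, pr w ≤ 1) (n a : ℕ) (w : ℤ) :
    0 ≤ leftsLaw pr n a w := by
  induction n generalizing a w with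
  | zero => cases a <;> simp [leftsLaw]
  | succ n ih =>
    induction a generalizing w with
    | zero => rw [leftsLaw]; exact mul_nonneg (h0 w) (ih 0 _)
    | succ a iha =>
      rw [leftsLaw]
      exact add_nonneg (mul_nonneg (h0 w) (ih _ _))
        (mul_nonneg (sub_nonneg.2 (h1 w)) (iha _))

theorem sum_leftsLaw_mul_succ (pr : ℤ → ℝ) (F : ℕ → ℝ) (n M : ℕ) (w : ℤ) :
    ∑ a ∈ Finset.range (M + 1), leftsLaw pr (n + 1) a w * F a =
      pr w * ∑ a ∈ Finset.range (M + 1), leftsLaw pr n a (w + 1) * F a +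
        (1 - pr w) * ∑ a ∈ Finset.range M, leftsLaw pr (n + 1) a (w - 1) * F (a + 1) := by
  rw [Finset.sum_range_succ', Finset.sum_range_succ' (fun a => leftsLaw pr n a (w + 1) * F a)]
  simp only [leftsLaw, Finset.mul_sum, mul_add, add_mul, Finset.sum_add_distrib]
  have : ∀ x y z t : ℝ, x = y → z = t → x + z = y + t := by rintro x y z t rfl rfl; rfl
  rw [add_right_comm]
  refine this _ _ _ _ (this _ _ _ _ ?_ ?_) ?_
  · exact Finset.sum_congr rfl fun _ _ => by ring
  · ring
  · exact Finset.sum_congr rfl fun _ _ => by ring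

theorem sum_leftsLaw_le_one {pr : ℤ → ℝ} (h0 : ∀ w, 0 ≤ pr w) (h1 : ∀ w, pr w ≤ 1) (n M : ℕ)
    (w : ℤ) : ∑ a ∈ Finset.range M, leftsLaw pr n a w ≤ 1 := by
  induction n generalizing M w with
  | zero =>
    cases M with
    | zero => simp
    | succ M => rw [Finset.sum_range_succ']; simp [leftsLaw]
  | succ n ih =>
    induction M generalizing w with
    | zero => simp
    | succ M ihM =>
      have := sum_leftsLaw_mul_succ pr (fun _ => 1) n M w
      simp only [mul_one] at this
      rw [this]
      have a1 := mul_le_mul_of_nonneg_left (ih (M + 1) (w + 1)) (h0 w)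
      have a2 := mul_le_mul_of_nonneg_left (ihM (w - 1)) (sub_nonneg.2 (h1 w))
      linarith

theorem summable_leftsLaw {pr : ℤ → ℝ} (h0 : ∀ w, 0 ≤ pr w) (h1 : ∀ w, pr w ≤ 1) (n : ℕ)
    (w : ℤ) : Summable fun a => leftsLaw pr n a w :=
  summable_of_sum_range_le (fun a => leftsLaw_nonneg h0 h1 n a w)
    (fun M => sum_leftsLaw_le_one h0 h1 n M w)

theorem tsum_leftsLaw_mul_succ {pr : ℤ → ℝ} (F : ℕ → ℝ) (n : ℕ) (w : ℤ)
    (hs : Summable fun a => leftsLaw pr n a (w + 1) * F a)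
    (hs' : Summable fun a => leftsLaw pr (n + 1) a (w - 1) * F (a + 1)) :
    HasSum (fun a => leftsLaw pr (n + 1) a w * F a)
      (pr w * ∑' a, leftsLaw pr n a (w + 1) * F a +
        (1 - pr w) * ∑' a, leftsLaw pr (n + 1) a (w - 1) * F (a + 1)) := by
  have h1 : Summable fun a => leftsLaw pr (n + 1) (a + 1) w * F (a + 1) := by
    have := (((summable_nat_add_iff 1).2 hs).mul_left (pr w)).add (hs'.mul_left (1 - pr w))
    refine this.congr fun a => ?_
    simp only [leftsLaw]; ring
  have h2 : Summable fun a => leftsLaw pr (n + 1) a w * F a := (summable_nat_add_iff 1).1 h1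
  refine (HasSum.tendsto_sum_nat h2.hasSum |> fun h => ?_)
  have h3 := (Filter.tendsto_add_atTop_iff_nat 1).2 h
  have h4 := ((((Filter.tendsto_add_atTop_iff_nat 1).2 hs.hasSum.tendsto_sum_nat)).const_mul
    (pr w)).add (hs'.hasSum.tendsto_sum_nat.const_mul (1 - pr w))
  have h5 := tendsto_nhds_unique h3 (h4.congr fun M => (sum_leftsLaw_mul_succ pr F n M w).symm)
  rw [← h5]
  exact h2.hasSum

/-- Mass conservation: up-steps occur infinitely often if `pr ≥ 1/2` on `(-∞, 0]`. -/
theorem tsum_leftsLaw {pr : ℤ → ℝ} (h0 : ∀ w, 0 ≤ pr w) (h1 : ∀ w, pr w ≤ 1)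
    (hh : ∀ w ≤ 0, 1 / 2 ≤ pr w) (n : ℕ) (w : ℤ) : ∑' a, leftsLaw pr n a w = 1 := by
  induction n generalizing w with
  | zero =>
    rw [tsum_eq_single 0 fun a ha => by
      obtain ⟨b, rfl⟩ := Nat.exists_eq_succ_of_ne_zero ha
      simp [leftsLaw]]
    simp [leftsLaw]
  | succ n ih =>
    have hs := fun n w => summable_leftsLaw h0 h1 n w
    have hrec : ∀ w, ∑' a, leftsLaw pr (n + 1) a w =
        pr w + (1 - pr w) * ∑' a, leftsLaw pr (n + 1) a (w - 1) := by
      intro w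
      have := (tsum_leftsLaw_mul_succ (pr := pr) (fun _ => 1) n w (by simpa using hs n (w + 1))
        (by simpa using hs (n + 1) (w - 1))).tsum_eq
      simpa [ih] using this
    have hle : ∀ w, ∑' a, leftsLaw pr (n + 1) a w ≤ 1 := fun w =>
      Real.tsum_le_of_sum_range_le (fun a => leftsLaw_nonneg h0 h1 _ a w)
        (fun M => sum_leftsLaw_le_one h0 h1 _ M w)
    refine le_antisymm (hle w) ?_
    have := nonneg_of_mul_pred_le (c := fun w => 1 - pr w)
      (k := fun w => ∑' a, leftsLaw pr (n + 1) a w - 1) (fun w => sub_nonneg.2 (h1 w))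
      (fun w hw => by linarith [hh w hw]) (fun w => by rw [hrec w]; linarith) 1 zero_le_one
      (fun w hw => by
        have : 0 ≤ ∑' a, leftsLaw pr (n + 1) a w := tsum_nonneg fun a => leftsLaw_nonneg h0 h1 _ a w
        have hw' : (w : ℝ) ≤ 0 := by exact_mod_cast hw
        linarith) w
    linarith

theorem sum_leftsLaw_mul_le {pr : ℤ → ℝ} (h0 : ∀ w, 0 ≤ pr w) (h1 : ∀ w, pr w ≤ 1)
    (hh : ∀ w ≤ 0, 1 / 2 ≤ pr w) (n M : ℕ) (w : ℤ) :
    ∑ a ∈ Finset.range M, leftsLaw pr n a w * a ≤ 2 * n + max (w : ℝ) 0 := by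
  induction n generalizing M w with
  | zero =>
    cases M with
    | zero => simp
    | succ M => rw [Finset.sum_range_succ']; simp [leftsLaw]
  | succ n ih =>
    induction M generalizing w with
    | zero => simp; positivity
    | succ M ihM =>
      rw [sum_leftsLaw_mul_succ]
      have e : ∑ a ∈ Finset.range M, leftsLaw pr (n + 1) a (w - 1) * ((a + 1 : ℕ) : ℝ) =
          ∑ a ∈ Finset.range M, leftsLaw pr (n + 1) a (w - 1) * a +
          ∑ a ∈ Finset.range M, leftsLaw pr (n + 1) a (w - 1) := by
        rw [← Finset.sum_add_distrib]
        exact Finset.sum_congr rfl fun a _ => by push_cast; ring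
      rw [e]
      have b1 := sum_leftsLaw_le_one h0 h1 (n + 1) M (w - 1)
      have a1 := mul_le_mul_of_nonneg_left (ih (M + 1) (w + 1)) (h0 w)
      have a2 := mul_le_mul_of_nonneg_left (add_le_add (ihM (w - 1)) b1) (sub_nonneg.2 (h1 w))
      refine (add_le_add a1 a2).trans ?_
      push_cast
      have p0 := h0 w
      have p1 := h1 w
      rcases lt_trichotomy w 0 with hw | rfl | hw
      · have hw1 : (w : ℝ) + 1 ≤ 0 := by exact_mod_cast hw
        rw [max_eq_right hw1, max_eq_right (by linarith : (w : ℝ) ≤ 0),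
          max_eq_right (by linarith : (w : ℝ) - 1 ≤ 0)]
        have := hh w hw.le
        linarith
      · have := hh 0 le_rfl
        norm_num
        linarith
      · have hw1 : (1 : ℝ) ≤ w := by exact_mod_cast hw
        rw [max_eq_left (by linarith : (0 : ℝ) ≤ (w : ℝ) + 1),
          max_eq_left (by linarith : (0 : ℝ) ≤ w),
          max_eq_left (by linarith : (0 : ℝ) ≤ (w : ℝ) - 1)]
        linarith

theorem summable_leftsLaw_mul {pr : ℤ → ℝ} (h0 : ∀ w, 0 ≤ pr w) (h1 : ∀ w, pr w ≤ 1)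
    (hh : ∀ w ≤ 0, 1 / 2 ≤ pr w) (n : ℕ) (w : ℤ) : Summable fun a : ℕ => leftsLaw pr n a w * a :=
  summable_of_sum_range_le
    (fun a => mul_nonneg (leftsLaw_nonneg h0 h1 n a w) (Nat.cast_nonneg a))
    (fun M => sum_leftsLaw_mul_le h0 h1 hh n M w)

/-- One less than the expected position at the time of the `n`-th up-step. -/
def meanAtUp (pr : ℤ → ℝ) (n : ℕ) (w : ℤ) : ℝ :=
  w + n - 1 - ∑' a : ℕ, leftsLaw pr n a w * a

theorem meanAtUp_zero (pr : ℤ → ℝ) (w : ℤ) : meanAtUp pr 0 w = w - 1 := by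
  rw [meanAtUp, tsum_eq_single 0
    (fun a ha => by obtain ⟨b, rfl⟩ := Nat.exists_eq_succ_of_ne_zero ha; simp [leftsLaw])]
  simp

theorem meanAtUp_succ {pr : ℤ → ℝ} (h0 : ∀ w, 0 ≤ pr w) (h1 : ∀ w, pr w ≤ 1)
    (hh : ∀ w ≤ 0, 1 / 2 ≤ pr w) (n : ℕ) (w : ℤ) :
    meanAtUp pr (n + 1) w =
      pr w * meanAtUp pr n (w + 1) + (1 - pr w) * meanAtUp pr (n + 1) (w - 1) := by
  have hs := summable_leftsLaw_mul h0 h1 hh n (w + 1)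
  have hs1 := summable_leftsLaw_mul h0 h1 hh (n + 1) (w - 1)
  have hs2 := summable_leftsLaw h0 h1 (n + 1) (w - 1)
  have e : (fun a : ℕ => leftsLaw pr (n + 1) a (w - 1) * ((a + 1 : ℕ) : ℝ)) =
      fun a : ℕ => leftsLaw pr (n + 1) a (w - 1) * a + leftsLaw pr (n + 1) a (w - 1) := by
    funext a; push_cast; ring
  have key := (tsum_leftsLaw_mul_succ (pr := pr) (fun a => (a : ℝ)) n w hs
    (by rw [e]; exact hs1.add hs2)).tsum_eq
  rw [e, hs1.tsum_add hs2, tsum_leftsLaw h0 h1 hh] at key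
  simp only [meanAtUp, key]
  push_cast
  ring

theorem abs_meanAtUp_le {pr : ℤ → ℝ} (h0 : ∀ w, 0 ≤ pr w) (h1 : ∀ w, pr w ≤ 1)
    (hh : ∀ w ≤ 0, 1 / 2 ≤ pr w) (n : ℕ) (w : ℤ) :
    |meanAtUp pr n w| ≤ 3 * n + 1 + 2 * |(w : ℝ)| := by
  have a1 : 0 ≤ ∑' a : ℕ, leftsLaw pr n a w * a :=
    tsum_nonneg fun a => mul_nonneg (leftsLaw_nonneg h0 h1 n a w) (Nat.cast_nonneg a)
  have a2 : ∑' a : ℕ, leftsLaw pr n a w * a ≤ 2 * n + max (w : ℝ) 0 :=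
    Real.tsum_le_of_sum_range_le
      (fun a => mul_nonneg (leftsLaw_nonneg h0 h1 n a w) (Nat.cast_nonneg a))
      (fun M => sum_leftsLaw_mul_le h0 h1 hh n M w)
  have a3 : max (w : ℝ) 0 ≤ |(w : ℝ)| := max_le (le_abs_self _) (abs_nonneg _)
  have a4 := le_abs_self (w : ℝ)
  have a5 := neg_abs_le (w : ℝ)
  have a6 : (0 : ℝ) ≤ n := Nat.cast_nonneg n
  unfold meanAtUp
  rw [abs_le]
  constructor <;> linarith

/-- The up-probability of the urn discrepancy chain. -/
def urnUp (lam : ℝ) (w : ℤ) : ℝ := lam ^ (2 * w - 1) / (1 + lam ^ (2 * w - 1))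

theorem urnUp_pos {lam : ℝ} (h0 : 0 < lam) (w : ℤ) : 0 < urnUp lam w := by
  unfold urnUp; positivity

theorem urnUp_lt_one {lam : ℝ} (h0 : 0 < lam) (w : ℤ) : urnUp lam w < 1 := by
  have : 0 < lam ^ (2 * w - 1) := by positivity
  unfold urnUp
  rw [div_lt_one (by positivity)]
  linarith

theorem one_sub_urnUp {lam : ℝ} (h0 : 0 < lam) (w : ℤ) :
    1 - urnUp lam w = 1 / (1 + lam ^ (2 * w - 1)) := by
  have : 0 < lam ^ (2 * w - 1) := by positivity
  unfold urnUp
  field_simp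
  ring

theorem half_le_urnUp {lam : ℝ} (h0 : 0 < lam) (h1 : lam < 1) (w : ℤ) (hw : w ≤ 0) :
    1 / 2 ≤ urnUp lam w := by
  have : 1 ≤ lam ^ (2 * w - 1) := one_le_zpow_of_nonpos₀ h0 h1.le (by omega)
  unfold urnUp
  rw [div_le_div_iff₀ (by norm_num) (by linarith)]
  linarith

theorem urnUp_le_half {lam : ℝ} (h0 : 0 < lam) (h1 : lam < 1) (w : ℤ) (hw : 1 ≤ w) :
    urnUp lam w ≤ 1 / 2 := by
  have : lam ^ (2 * w - 1) ≤ 1 := zpow_le_one₀ h0 h1.le (by omega)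
  have : 0 < lam ^ (2 * w - 1) := by positivity
  unfold urnUp
  rw [div_le_div_iff₀ (by linarith) (by norm_num)]
  linarith

theorem urn_meanAtUp_succ {lam : ℝ} (h0 : 0 < lam) (h1 : lam < 1) (n : ℕ) (w : ℤ) :
    meanAtUp (urnUp lam) (n + 1) w - meanAtUp (urnUp lam) (n + 1) (w - 1) =
      lam ^ (2 * w - 1) *
        (meanAtUp (urnUp lam) n (w + 1) - meanAtUp (urnUp lam) (n + 1) w) := by
  have h := meanAtUp_succ (fun w => (urnUp_pos h0 w).le) (fun w => (urnUp_lt_one h0 w).le)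
    (half_le_urnUp h0 h1) n w
  rw [one_sub_urnUp h0, urnUp] at h
  have : 0 < lam ^ (2 * w - 1) := by positivity
  field_simp at h
  linarith

theorem urn_abs_meanAtUp_le {lam : ℝ} (h0 : 0 < lam) (h1 : lam < 1) (n : ℕ) (w : ℤ) :
    |meanAtUp (urnUp lam) n w| ≤ 3 * n + 1 + 2 * |(w : ℝ)| :=
  abs_meanAtUp_le (fun w => (urnUp_pos h0 w).le) (fun w => (urnUp_lt_one h0 w).le)
    (half_le_urnUp h0 h1) n w

/-- The discrete derivative of `meanAtUp` for the urn discrepancy chain. -/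
def meanDiff (lam : ℝ) (n : ℕ) (w : ℤ) : ℝ :=
  meanAtUp (urnUp lam) n w - meanAtUp (urnUp lam) n (w - 1)

theorem meanDiff_zero (lam : ℝ) (w : ℤ) : meanDiff lam 0 w = 1 := by
  simp [meanDiff, meanAtUp_zero]

theorem abs_meanDiff_le {lam : ℝ} (h0 : 0 < lam) (h1 : lam < 1) (n : ℕ) (w : ℤ) :
    |meanDiff lam n w| ≤ 6 * n + 4 + 4 * |(w : ℝ)| := by
  have a1 := urn_abs_meanAtUp_le h0 h1 n w
  have a2 := urn_abs_meanAtUp_le h0 h1 n (w - 1)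
  have a3 : |((w - 1 : ℤ) : ℝ)| ≤ |(w : ℝ)| + 1 := by
    push_cast
    exact (abs_sub _ _).trans (by simp)
  exact (abs_sub _ _).trans (by linarith)

theorem meanDiff_succ {lam : ℝ} (h0 : 0 < lam) (h1 : lam < 1) (n : ℕ) (w : ℤ) :
    (1 + lam ^ (2 * w - 1)) * meanDiff lam (n + 1) w =
      lam ^ (2 * w - 1) * meanDiff lam n (w + 1) + lam ^ 2 * meanDiff lam (n + 1) (w - 1) := by
  have a1 := urn_meanAtUp_succ h0 h1 n w
  have a2 := urn_meanAtUp_succ h0 h1 n (w - 1)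
  have a3 : lam ^ (2 * w - 1) = lam ^ 2 * lam ^ (2 * (w - 1) - 1) := by
    rw [← zpow_natCast, ← zpow_add₀ h0.ne']; congr 1; push_cast; ring
  rw [sub_add_cancel] at a2
  simp only [meanDiff, add_sub_cancel_right]
  rw [a2, ← mul_assoc, ← a3]
  linarith

theorem weight_nonneg {lam : ℝ} (h0 : 0 < lam) (w : ℤ) :
    0 ≤ lam ^ 2 / (1 + lam ^ (2 * w - 1)) := by positivity

theorem weight_le_half {lam : ℝ} (h0 : 0 < lam) (h1 : lam < 1) (w : ℤ) (hw : w ≤ 0) :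
    lam ^ 2 / (1 + lam ^ (2 * w - 1)) ≤ 1 / 2 := by
  have : 1 ≤ lam ^ (2 * w - 1) := one_le_zpow_of_nonpos₀ h0 h1.le (by omega)
  rw [div_le_div_iff₀ (by linarith) (by norm_num)]
  nlinarith

theorem meanDiff_pos {lam : ℝ} (h0 : 0 < lam) (h1 : lam < 1) (n : ℕ) (w : ℤ) :
    0 < meanDiff lam n w := by
  induction n generalizing w with
  | zero => simp [meanDiff_zero]
  | succ n ih =>
    have hr : ∀ w : ℤ, 0 < lam ^ (2 * w - 1) := fun w => by positivity
    have hnn : ∀ w, 0 ≤ meanDiff lam (n + 1) w := by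
      refine nonneg_of_mul_pred_le (c := fun w => lam ^ 2 / (1 + lam ^ (2 * w - 1)))
        (weight_nonneg h0) (weight_le_half h0 h1) (fun w => ?_) (6 * n + 10) (by positivity)
        (fun w hw => ?_)
      · have := meanDiff_succ h0 h1 n w
        rw [div_mul_eq_mul_div, div_le_iff₀ (by linarith [hr w])]
        have := mul_pos (hr w) (ih (w + 1))
        linarith
      · have a1 := (abs_le.1 (abs_meanDiff_le h0 h1 (n + 1) w)).1
        have hw' : (w : ℝ) ≤ 0 := by exact_mod_cast hw
        rw [abs_of_nonpos hw'] at a1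
        push_cast at a1
        have : 0 ≤ (n : ℝ) * (-w) := mul_nonneg (Nat.cast_nonneg n) (by linarith)
        linarith
    have a1 := meanDiff_succ h0 h1 n w
    have a2 := mul_pos (hr w) (ih (w + 1))
    have a3 := mul_nonneg (sq_nonneg lam) (hnn (w - 1))
    have a4 : 0 < (1 + lam ^ (2 * w - 1)) * meanDiff lam (n + 1) w := by linarith
    exact pos_of_mul_pos_right a4 (by linarith [hr w])

theorem sq_mul_meanDiff_le {lam : ℝ} (h0 : 0 < lam) (h1 : lam < 1) (n : ℕ) (w : ℤ) :
    lam ^ 2 * meanDiff lam n (w - 1) ≤ meanDiff lam n w := by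
  induction n generalizing w with
  | zero => simp only [meanDiff_zero]; nlinarith
  | succ n ih =>
    have hr : ∀ w : ℤ, 0 < lam ^ (2 * w - 1) := fun w => by positivity
    have hnn : ∀ w, 0 ≤ meanDiff lam n (w + 1) - meanDiff lam (n + 1) w := by
      refine nonneg_of_mul_pred_le (c := fun w => lam ^ 2 / (1 + lam ^ (2 * w - 1)))
        (weight_nonneg h0) (weight_le_half h0 h1) (fun w => ?_) (12 * n + 18) (by positivity)
        (fun w hw => ?_)
      · have a1 := meanDiff_succ h0 h1 n w
        have a2 := ih (w + 1)
        rw [add_sub_cancel_right] at a2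
        rw [div_mul_eq_mul_div, div_le_iff₀ (by linarith [hr w]), sub_add_cancel]
        linarith
      · have a1 := (abs_le.1 (abs_meanDiff_le h0 h1 (n + 1) w)).2
        have a2 := (abs_le.1 (abs_meanDiff_le h0 h1 n (w + 1))).1
        have hw' : (w : ℝ) ≤ 0 := by exact_mod_cast hw
        have a3 : |((w + 1 : ℤ) : ℝ)| ≤ |(w : ℝ)| + 1 := by
          push_cast
          exact (abs_add_le _ _).trans (by simp)
        rw [abs_of_nonpos hw'] at a1 a3
        push_cast at a1
        have : 0 ≤ (n : ℝ) * (-w) := mul_nonneg (Nat.cast_nonneg n) (by linarith)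
        linarith
    have a1 := meanDiff_succ h0 h1 n w
    have a2 := mul_nonneg (hr w).le (hnn w)
    linarith

theorem meanAtUp_secant {lam : ℝ} (h0 : 0 < lam) (h1 : lam < 1) (n : ℕ) (w : ℤ) :
    meanAtUp (urnUp lam) n 0 + meanDiff lam n 1 / (1 - lam ^ 2) * (1 - lam ^ (2 * w)) ≤
      meanAtUp (urnUp lam) n w := by
  have hmono : Monotone fun w : ℤ => meanDiff lam n w * lam ^ (-(2 * w)) := by
    refine monotone_int_of_le_succ fun w => ?_
    have a1 := sq_mul_meanDiff_le h0 h1 n (w + 1)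
    rw [add_sub_cancel_right] at a1
    have a2 : lam ^ (-(2 * w)) = lam ^ 2 * lam ^ (-(2 * (w + 1))) := by
      rw [← zpow_natCast, ← zpow_add₀ h0.ne']; congr 1; push_cast; ring
    rw [a2]
    have a3 : 0 < lam ^ (-(2 * (w + 1))) := by positivity
    nlinarith
  have hl : 0 < 1 - lam ^ 2 := by nlinarith
  set κ := meanDiff lam n 1 / (1 - lam ^ 2) with hκ
  have hκ' : κ * (1 - lam ^ 2) = meanDiff lam n 1 := by rw [hκ]; field_simp
  have hstep : ∀ w : ℤ, (meanAtUp (urnUp lam) n w - κ * (1 - lam ^ (2 * w))) -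
      (meanAtUp (urnUp lam) n (w - 1) - κ * (1 - lam ^ (2 * (w - 1)))) =
      meanDiff lam n w - meanDiff lam n 1 * lam ^ (2 * (w - 1)) := by
    intro w
    have a2 : lam ^ (2 * w) = lam ^ 2 * lam ^ (2 * (w - 1)) := by
      rw [← zpow_natCast, ← zpow_add₀ h0.ne']; congr 1; push_cast; ring
    rw [a2, ← hκ', meanDiff]
    ring
  have hcmp : ∀ w : ℤ, meanDiff lam n w - meanDiff lam n 1 * lam ^ (2 * (w - 1)) =
      (meanDiff lam n w * lam ^ (-(2 * w)) - meanDiff lam n 1 * lam ^ (-(2 * 1) : ℤ)) *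
        lam ^ (2 * w) := by
    intro w
    rw [sub_mul, mul_assoc, mul_assoc, ← zpow_add₀ h0.ne', ← zpow_add₀ h0.ne',
      neg_add_cancel, zpow_zero, mul_one, show -(2 * 1) + 2 * w = 2 * (w - 1) by ring]
  suffices h : ∀ w : ℤ, meanAtUp (urnUp lam) n 0 ≤
      meanAtUp (urnUp lam) n w - κ * (1 - lam ^ (2 * w)) by linarith [h w]
  intro w
  induction w using Int.induction_on with
  | zero => simp
  | succ i ih =>
    have a1 := hstep (i + 1)
    rw [hcmp, add_sub_cancel_right] at a1
    have a2 : meanDiff lam n 1 * lam ^ (-(2 * 1) : ℤ) ≤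
      meanDiff lam n (i + 1) * lam ^ (-(2 * (i + 1)) : ℤ) := hmono (by omega : (1 : ℤ) ≤ i + 1)
    have a3 : 0 < lam ^ (2 * ((i : ℤ) + 1)) := by positivity
    have a4 := mul_nonneg (sub_nonneg.2 a2) a3.le
    linarith
  | pred i ih =>
    have a1 := hstep (-i)
    rw [hcmp] at a1
    have a2 : meanDiff lam n (-i) * lam ^ (-(2 * (-i)) : ℤ) ≤
      meanDiff lam n 1 * lam ^ (-(2 * 1) : ℤ) := hmono (by omega : -(i : ℤ) ≤ 1)
    have a3 : 0 < lam ^ (2 * (-(i : ℤ))) := by positivity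
    have a4 := mul_nonneg (sub_nonneg.2 a2) a3.le
    linarith

theorem summable_gauss_mul {lam : ℝ} (h0 : 0 < lam) (h1 : lam < 1) (f : ℤ → ℝ) (C : ℝ)
    (hf : ∀ w, |f w| ≤ C * (1 + |(w : ℝ)| ^ 2)) : Summable fun w : ℤ => lam ^ (w ^ 2) * f w := by
  have hC : 0 ≤ C := by simpa using (abs_nonneg _).trans (hf 0)
  have hg : Summable fun w : ℤ => lam ^ w.natAbs * (C * (1 + |(w : ℝ)| ^ 2)) := by
    have : Summable fun n : ℕ => lam ^ n * (C * (1 + (n : ℝ) ^ 2)) := by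
      have b0 := summable_geometric_of_lt_one h0.le h1
      have b1 := summable_pow_mul_geometric_of_norm_lt_one (R := ℝ) 2 (r := lam)
        (by rwa [Real.norm_of_nonneg h0.le])
      refine ((b0.add b1).mul_left C).congr fun n => ?_
      ring
    refine Summable.of_nat_of_neg ?_ ?_
    · simpa using this
    · simpa using this
  refine Summable.of_norm_bounded hg fun w => ?_
  have hp : 0 < lam ^ (w ^ 2) := by positivity
  rw [Real.norm_eq_abs, abs_mul, abs_of_pos hp]
  refine mul_le_mul ?_ (hf w) (abs_nonneg _) (by positivity)
  rw [← zpow_natCast lam w.natAbs]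
  refine zpow_le_zpow_right_of_le_one₀ h0 h1.le ?_
  rw [← Int.natAbs_sq]
  have : w.natAbs ≤ w.natAbs ^ 2 := Nat.le_self_pow two_ne_zero _
  exact_mod_cast this

theorem summable_gauss_mul_meanAtUp {lam : ℝ} (h0 : 0 < lam) (h1 : lam < 1) (n : ℕ) (a : ℤ) :
    Summable fun w : ℤ => lam ^ (w ^ 2) * meanAtUp (urnUp lam) n (w + a) := by
  refine summable_gauss_mul h0 h1 _ (3 * n + 3 + 2 * |(a : ℝ)|) fun w => ?_
  have a1 := urn_abs_meanAtUp_le h0 h1 n (w + a)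
  have a2 := abs_add_le (w : ℝ) (a : ℝ)
  push_cast at a1
  have a3 := abs_nonneg (w : ℝ)
  have a4 := abs_nonneg (a : ℝ)
  have a5 : (0 : ℝ) ≤ n := Nat.cast_nonneg n
  nlinarith [sq_nonneg (|(w : ℝ)| - 1), mul_nonneg (sq_nonneg |(w : ℝ)|) a4,
    mul_nonneg (sq_nonneg |(w : ℝ)|) a5]

theorem tsum_gauss_mul_meanAtUp {lam : ℝ} (h0 : 0 < lam) (h1 : lam < 1) (n : ℕ) :
    ∑' w : ℤ, lam ^ (w ^ 2) * meanAtUp (urnUp lam) n (w + 1) = 0 := by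
  induction n with
  | zero =>
    have h : ∑' w : ℤ, lam ^ (w ^ 2) * meanAtUp (urnUp lam) 0 (w + 1) =
        -∑' w : ℤ, lam ^ (w ^ 2) * meanAtUp (urnUp lam) 0 (w + 1) := by
      conv_lhs => rw [← (Equiv.neg ℤ).tsum_eq]
      rw [← tsum_neg]
      refine tsum_congr fun w => ?_
      simp [meanAtUp_zero]
    linarith
  | succ n ih =>
    have s1 := summable_gauss_mul_meanAtUp h0 h1 n 1
    have s2 := summable_gauss_mul_meanAtUp h0 h1 (n + 1) 0
    have s3 := summable_gauss_mul_meanAtUp h0 h1 (n + 1) 1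
    simp only [add_zero] at s2
    have e : ∑' w : ℤ, (lam ^ ((w - 1) ^ 2) * meanAtUp (urnUp lam) (n + 1) (w - 1 + 1) -
        lam ^ ((w - 1) ^ 2) * meanAtUp (urnUp lam) (n + 1) (w - 1)) =
        ∑' w : ℤ, (lam ^ (w ^ 2) * meanAtUp (urnUp lam) n (w + 1) -
          lam ^ (w ^ 2) * meanAtUp (urnUp lam) (n + 1) w) := by
      refine tsum_congr fun w => ?_
      have a1 := urn_meanAtUp_succ h0 h1 n w
      rw [sub_add_cancel, ← mul_sub, a1, ← mul_assoc, ← zpow_add₀ h0.ne', ← mul_sub]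
      congr 2
      ring
    rw [s1.tsum_sub s2, ih] at e
    have e2 := (Equiv.subRight (1 : ℤ)).tsum_eq
      (fun w : ℤ => lam ^ (w ^ 2) * meanAtUp (urnUp lam) (n + 1) (w + 1) -
        lam ^ (w ^ 2) * meanAtUp (urnUp lam) (n + 1) w)
    simp only [Equiv.subRight_apply] at e2
    rw [e2, s3.tsum_sub s2] at e
    linarith

theorem meanAtUp_neg {lam : ℝ} (h0 : 0 < lam) (h1 : lam < 1) (n : ℕ) :
    meanAtUp (urnUp lam) n 0 < 0 := by
  obtain ⟨κ, hκ⟩ : ∃ κ, κ = meanDiff lam n 1 / (1 - lam ^ 2) := ⟨_, rfl⟩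
  have hl : 0 < 1 - lam ^ 2 := by nlinarith
  have hκ0 : 0 < κ := by
    rw [hκ]; exact div_pos (meanDiff_pos h0 h1 n 1) hl
  have s0 : Summable fun w : ℤ => lam ^ (w ^ 2) := by
    simpa using summable_gauss_mul h0 h1 (fun _ => 1) 1 (fun w => by simp [sq_nonneg])
  obtain ⟨Θ, hΘ⟩ : ∃ Θ, Θ = ∑' w : ℤ, lam ^ (w ^ 2) := ⟨_, rfl⟩
  have hΘ0 : 0 < Θ := by
    rw [hΘ]; exact s0.tsum_pos (fun w => (zpow_pos h0 _).le) 0 (zpow_pos h0 _)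
  have s1 : Summable fun w : ℤ => lam ^ ((w + 1) ^ 2) :=
    ((Equiv.addRight (1 : ℤ)).summable_iff.2 s0).congr fun w => by simp
  have t1 : ∑' w : ℤ, lam ^ ((w + 1) ^ 2) = Θ := by
    rw [hΘ, ← (Equiv.addRight (1 : ℤ)).tsum_eq fun w : ℤ => lam ^ (w ^ 2)]
    exact tsum_congr fun w => by simp
  have hle : ∑' w : ℤ, ((meanAtUp (urnUp lam) n 0 + κ) * lam ^ (w ^ 2) -
      κ * lam * lam ^ ((w + 1) ^ 2)) ≤
      ∑' w : ℤ, lam ^ (w ^ 2) * meanAtUp (urnUp lam) n (w + 1) := by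
    refine Summable.tsum_le_tsum (fun w => ?_) ((s0.mul_left _).sub (s1.mul_left _))
      (summable_gauss_mul_meanAtUp h0 h1 n 1)
    have a1 := meanAtUp_secant h0 h1 n (w + 1)
    have a2 : 0 < lam ^ (w ^ 2) := by positivity
    have a3 : lam * lam ^ ((w + 1) ^ 2) = lam ^ (w ^ 2) * lam ^ (2 * (w + 1)) := by
      rw [← zpow_one_add₀ h0.ne', ← zpow_add₀ h0.ne']; congr 1; ring
    rw [mul_assoc, a3]
    have := mul_le_mul_of_nonneg_left a1 a2.le
    rw [← hκ] at this
    linarith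
  rw [tsum_gauss_mul_meanAtUp h0 h1, (s0.mul_left _).tsum_sub (s1.mul_left _), tsum_mul_left,
    tsum_mul_left, t1, ← hΘ] at hle
  have : (meanAtUp (urnUp lam) n 0 + κ * (1 - lam)) * Θ ≤ 0 := by linarith
  have := nonpos_of_mul_nonpos_left this hΘ0
  have := mul_pos hκ0 (sub_pos.2 h1)
  linarith

/-- The mean number of down-steps before the `(n+1)`-th up-step exceeds `n`. -/
theorem lt_mean_leftsLaw {lam : ℝ} (h0 : 0 < lam) (h1 : lam < 1) (n : ℕ) :
    (n : ℝ) < ∑' a : ℕ, leftsLaw (urnUp lam) (n + 1) a 0 * a := by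
  have := meanAtUp_neg h0 h1 (n + 1)
  unfold meanAtUp at this
  push_cast at this
  linarith

/-- The `t`-step transition probabilities of the nearest-neighbour chain on `ℤ` with
up-probabilities `pr`. -/
def chainLaw (pr : ℤ → ℝ) : ℕ → ℤ → ℤ → ℝ
  | 0, w, y => if w = y then 1 else 0
  | t + 1, w, y => pr w * chainLaw pr t (w + 1) y + (1 - pr w) * chainLaw pr t (w - 1) y

theorem chainLaw_succ' (pr : ℤ → ℝ) (t : ℕ) (w y : ℤ) :
    chainLaw pr (t + 1) w y =
      pr (y - 1) * chainLaw pr t w (y - 1) + (1 - pr (y + 1)) * chainLaw pr t w (y + 1) := by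
  induction t generalizing w y with
  | zero =>
    simp only [chainLaw]
    by_cases h1 : w + 1 = y
    · subst h1
      simp only [if_pos, add_sub_cancel_right]
      rw [if_neg (by omega), if_neg (by omega)]
      simp
    · by_cases h2 : w - 1 = y
      · subst h2
        have h3 : ¬w = w - 1 - 1 := by omega
        rw [if_neg h1, if_neg h3, if_pos rfl, if_pos (sub_add_cancel w 1).symm]
        simp
      · rw [if_neg h1, if_neg h2, if_neg (by omega), if_neg (by omega)]
        simp
  | succ t ih =>
    rw [chainLaw, ih, ih]
    conv_rhs => rw [chainLaw, chainLaw]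
    ring

theorem chainLaw_nonneg {pr : ℤ → ℝ} (h0 : ∀ w, 0 ≤ pr w) (h1 : ∀ w, pr w ≤ 1) (t : ℕ)
    (w y : ℤ) : 0 ≤ chainLaw pr t w y := by
  induction t generalizing w with
  | zero => unfold chainLaw; split_ifs <;> norm_num
  | succ t ih =>
    rw [chainLaw]
    exact add_nonneg (mul_nonneg (h0 w) (ih _)) (mul_nonneg (sub_nonneg.2 (h1 w)) (ih _))

theorem chainLaw_le_one {pr : ℤ → ℝ} (h0 : ∀ w, 0 ≤ pr w) (h1 : ∀ w, pr w ≤ 1) (t : ℕ)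
    (w y : ℤ) : chainLaw pr t w y ≤ 1 := by
  induction t generalizing w with
  | zero => unfold chainLaw; split_ifs <;> norm_num
  | succ t ih =>
    rw [chainLaw]
    have a1 := mul_le_mul_of_nonneg_left (ih (w + 1)) (h0 w)
    have a2 := mul_le_mul_of_nonneg_left (ih (w - 1)) (sub_nonneg.2 (h1 w))
    linarith

theorem chainLaw_eq_zero (pr : ℤ → ℝ) (t : ℕ) (w y : ℤ) (h : w + t < y ∨ y < w - t) :
    chainLaw pr t w y = 0 := by
  induction t generalizing w with
  | zero => rw [chainLaw, if_neg]; push_cast at h; omega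
  | succ t ih =>
    rw [chainLaw, ih, ih]
    · simp
    · push_cast at h; omega
    · push_cast at h; omega

theorem leftsLaw_eq_chainLaw (pr : ℤ → ℝ) (n a : ℕ) (w : ℤ) :
    leftsLaw pr (n + 1) a w = chainLaw pr (n + a) w (w + n - a) * pr (w + n - a) := by
  induction n generalizing a w with
  | zero =>
    induction a generalizing w with
    | zero => simp [leftsLaw, chainLaw]
    | succ a iha =>
      rw [leftsLaw, iha, leftsLaw, ← add_assoc, chainLaw,
        chainLaw_eq_zero pr (0 + a) (w + 1) _ (by push_cast; omega)]
      push_cast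
      rw [show w - 1 + 0 - (a : ℤ) = w + 0 - (a + 1) by ring]
      ring
  | succ n ih =>
    induction a generalizing w with
    | zero =>
      rw [leftsLaw, ih, add_zero, add_zero, chainLaw,
        chainLaw_eq_zero pr n (w - 1) _ (by push_cast; omega)]
      push_cast
      rw [show w + 1 + (n : ℤ) - 0 = w + (n + 1) - 0 by ring]
      ring
    | succ a iha =>
      rw [leftsLaw, iha, ih, show n + (a + 1) = n + 1 + a by ring, ← add_assoc (n + 1) a 1,
        chainLaw]
      push_cast
      rw [show w + 1 + (n : ℤ) - (a + 1) = w + (n + 1) - (a + 1) by ring,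
        show w - 1 + ((n : ℤ) + 1) - a = w + (n + 1) - (a + 1) by ring]
      ring

theorem chainLaw_reversible {pr π : ℤ → ℝ}
    (h : ∀ w, π w * pr w = π (w + 1) * (1 - pr (w + 1))) (t : ℕ) (w y : ℤ) :
    π w * chainLaw pr t w y = π y * chainLaw pr t y w := by
  induction t generalizing w with
  | zero =>
    simp only [chainLaw]
    by_cases e : w = y
    · subst e; rfl
    · rw [if_neg e, if_neg (Ne.symm e)]; simp
  | succ t ih =>
    have a1 := h w
    have a2 := h (w - 1)
    rw [sub_add_cancel] at a2
    have b1 := ih (w + 1)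
    have b2 := ih (w - 1)
    rw [chainLaw_succ' pr t y w, chainLaw]
    linear_combination (chainLaw pr t (w + 1) y) * a1 + (1 - pr (w + 1)) * b1
      - (chainLaw pr t (w - 1) y) * a2 + pr (w - 1) * b2

theorem leftsLaw_le_gauss {lam : ℝ} (h0 : 0 < lam) (n a : ℕ) :
    leftsLaw (urnUp lam) (n + 1) a 0 ≤ lam⁻¹ * lam ^ (((n : ℤ) - a) ^ 2) := by
  have hp0 := fun w => (urnUp_pos h0 w).le
  have hp1 := fun w => (urnUp_lt_one h0 w).le
  rw [leftsLaw_eq_chainLaw, zero_add]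
  obtain ⟨y, hy⟩ : ∃ y : ℤ, y = (n : ℤ) - a := ⟨_, rfl⟩
  rw [← hy]
  have hup : ∀ w : ℤ, (1 + lam ^ (2 * w - 1)) * lam ^ (w ^ 2 - 2 * w) * urnUp lam w =
      lam⁻¹ * lam ^ (w ^ 2) := by
    intro w
    have : 0 < lam ^ (2 * w - 1) := by positivity
    have e : lam⁻¹ * lam ^ (w ^ 2) = lam ^ (2 * w - 1) * lam ^ (w ^ 2 - 2 * w) := by
      rw [← zpow_neg_one, ← zpow_add₀ h0.ne', ← zpow_add₀ h0.ne']; congr 1; ring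
    rw [e, urnUp]
    field_simp
  have hdown : ∀ w : ℤ, (1 + lam ^ (2 * (w + 1) - 1)) * lam ^ ((w + 1) ^ 2 - 2 * (w + 1)) *
      (1 - urnUp lam (w + 1)) = lam⁻¹ * lam ^ (w ^ 2) := by
    intro w
    have : 0 < lam ^ (2 * (w + 1) - 1) := by positivity
    have e : lam⁻¹ * lam ^ (w ^ 2) = lam ^ ((w + 1) ^ 2 - 2 * (w + 1)) := by
      rw [← zpow_neg_one, ← zpow_add₀ h0.ne']; congr 1; ring
    rw [e, one_sub_urnUp h0]
    field_simp
  have hrev := chainLaw_reversible (pr := urnUp lam)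
    (π := fun w => (1 + lam ^ (2 * w - 1)) * lam ^ (w ^ 2 - 2 * w))
    (fun w => (hup w).trans (hdown w).symm) (n + a) 0 y
  have hπ : 1 ≤ (1 + lam ^ (2 * (0 : ℤ) - 1)) * lam ^ ((0 : ℤ) ^ 2 - 2 * 0) := by
    have : 0 < lam ^ (2 * (0 : ℤ) - 1) := by positivity
    simp only [mul_zero, sub_zero, ne_eq, OfNat.ofNat_ne_zero, not_false_eq_true, zero_pow,
      zpow_zero, mul_one]
    linarith [zpow_pos h0 (0 - 1)]
  have hπy : 0 ≤ (1 + lam ^ (2 * y - 1)) * lam ^ (y ^ 2 - 2 * y) := by positivity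
  have a1 := mul_le_mul_of_nonneg_left (chainLaw_le_one hp0 hp1 (n + a) y 0) hπy
  have a2 := mul_le_mul_of_nonneg_right hπ (chainLaw_nonneg hp0 hp1 (n + a) 0 y)
  have a3 : chainLaw (urnUp lam) (n + a) 0 y ≤ (1 + lam ^ (2 * y - 1)) * lam ^ (y ^ 2 - 2 * y) := by
    linarith [hrev]
  have := mul_le_mul_of_nonneg_right a3 (hp0 y)
  rw [hup] at this
  exact this

theorem leftsLaw_second_moment {lam : ℝ} (h0 : 0 < lam) (h1 : lam < 1) :
    ∃ C : ℝ, 0 ≤ C ∧ ∀ n : ℕ,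
      Summable (fun a : ℕ => leftsLaw (urnUp lam) (n + 1) a 0 * ((a : ℝ) - n) ^ 2) ∧
      ∑' a : ℕ, leftsLaw (urnUp lam) (n + 1) a 0 * ((a : ℝ) - n) ^ 2 ≤ C := by
  have s : Summable fun w : ℤ => lam⁻¹ * (lam ^ (w ^ 2) * (w : ℝ) ^ 2) :=
    (summable_gauss_mul h0 h1 (fun w => (w : ℝ) ^ 2) 1 (fun w => by
      rw [abs_of_nonneg (sq_nonneg _), sq_abs]; linarith)).mul_left _
  refine ⟨∑' w : ℤ, lam⁻¹ * (lam ^ (w ^ 2) * (w : ℝ) ^ 2), tsum_nonneg fun w => by positivity,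
    fun n => ?_⟩
  have hinj : Function.Injective fun a : ℕ => (n : ℤ) - a := fun a b h => by
    simp only at h; omega
  have s' := s.comp_injective hinj
  have hle : ∀ a : ℕ, leftsLaw (urnUp lam) (n + 1) a 0 * ((a : ℝ) - n) ^ 2 ≤
      ((fun w : ℤ => lam⁻¹ * (lam ^ (w ^ 2) * (w : ℝ) ^ 2)) ∘ fun a : ℕ => (n : ℤ) - a) a := by
    intro a
    have := mul_le_mul_of_nonneg_right (leftsLaw_le_gauss h0 n a) (sq_nonneg ((a : ℝ) - n))
    refine this.trans (le_of_eq ?_)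
    simp only [Function.comp]
    push_cast
    ring
  have hnn : ∀ a : ℕ, 0 ≤ leftsLaw (urnUp lam) (n + 1) a 0 * ((a : ℝ) - n) ^ 2 := fun a =>
    mul_nonneg (leftsLaw_nonneg (fun w => (urnUp_pos h0 w).le) (fun w => (urnUp_lt_one h0 w).le)
      _ _ _) (sq_nonneg _)
  have s'' := Summable.of_nonneg_of_le hnn hle s'
  refine ⟨s'', (s''.tsum_le_tsum hle s').trans ?_⟩
  exact tsum_comp_le_tsum_of_inj s (fun w => by positivity) hinj

/-- A bounded concave function on the nonnegative half-line. -/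
def satur (N : ℕ) (z : ℕ) : ℝ := N * z / (N + z)

theorem satur_nonneg (N z : ℕ) : 0 ≤ satur N z := by unfold satur; positivity

theorem satur_le (N z : ℕ) : satur N z ≤ N := by
  unfold satur
  refine div_le_of_le_mul₀ (by positivity) (by positivity) ?_
  have : (0 : ℝ) ≤ (N : ℝ) * N := by positivity
  linarith

theorem satur_sub_le {N : ℕ} (hN : 0 < N) (z w : ℕ) :
    satur N z + (N / (N + z)) ^ 2 * ((w : ℝ) - z) - ((w : ℝ) - z) ^ 2 / N ≤ satur N w := by
  have hN' : (0 : ℝ) < N := by exact_mod_cast hN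
  have hz : (0 : ℝ) ≤ z := Nat.cast_nonneg z
  have hw : (0 : ℝ) ≤ w := Nat.cast_nonneg w
  have key : satur N w = satur N z + (N / (N + z)) ^ 2 * ((w : ℝ) - z) -
      (N / (N + z)) ^ 2 * (((w : ℝ) - z) ^ 2 / (N + w)) := by
    unfold satur
    have : (N : ℝ) + z ≠ 0 := by positivity
    have : (N : ℝ) + w ≠ 0 := by positivity
    field_simp
    ring
  have b1 : ((w : ℝ) - z) ^ 2 / (N + w) ≤ ((w : ℝ) - z) ^ 2 / N :=
    div_le_div_of_nonneg_left (sq_nonneg _) hN' (by linarith)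
  have b2 : ((N : ℝ) / (N + z)) ^ 2 ≤ 1 := by
    refine pow_le_one₀ (by positivity) ?_
    rw [div_le_one (by positivity)]; linarith
  have b3 : 0 ≤ ((w : ℝ) - z) ^ 2 / (N + w) := by positivity
  have := mul_le_mul_of_nonneg_right b2 b3
  rw [key]
  linarith

/-- Drift of `satur` under the kernel `n ↦ leftsLaw (n + 1)`. -/
theorem satur_drift {lam : ℝ} (h0 : 0 < lam) (h1 : lam < 1) :
    ∃ C : ℝ, 0 ≤ C ∧ ∀ L : ℕ, ∃ δ : ℝ, 0 < δ ∧ ∀ N : ℕ, 0 < N → L ≤ N → ∀ n : ℕ,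
      satur N n + (if n ≤ L then δ else 0) - C / N ≤
        ∑' a : ℕ, leftsLaw (urnUp lam) (n + 1) a 0 * satur N a := by
  obtain ⟨C, hC, hsm⟩ := leftsLaw_second_moment h0 h1
  have hp0 := fun w => (urnUp_pos h0 w).le
  have hp1 := fun w => (urnUp_lt_one h0 w).le
  refine ⟨C, hC, fun L => ?_⟩
  obtain ⟨m, hm, hmin⟩ := Finset.exists_min_image (Finset.range (L + 1))
    (fun n : ℕ => ∑' a : ℕ, leftsLaw (urnUp lam) (n + 1) a 0 * a - n) ⟨0, by simp⟩
  have hd := fun n => sub_pos.2 (lt_mean_leftsLaw h0 h1 n)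
  refine ⟨(∑' a : ℕ, leftsLaw (urnUp lam) (m + 1) a 0 * a - m) / 4, by linarith [hd m],
    fun N hN hLN n => ?_⟩
  have hN' : (0 : ℝ) < N := by exact_mod_cast hN
  have s0 := summable_leftsLaw hp0 hp1 (n + 1) 0
  have s1 := summable_leftsLaw_mul hp0 hp1 (half_le_urnUp h0 h1) (n + 1) 0
  obtain ⟨s2, hle2⟩ := hsm n
  have t0 := tsum_leftsLaw hp0 hp1 (half_le_urnUp h0 h1) (n + 1) 0
  have hnn := fun a => leftsLaw_nonneg hp0 hp1 (n + 1) a 0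
  obtain ⟨q, hq⟩ : ∃ q : ℝ, q = ((N : ℝ) / (N + n)) ^ 2 := ⟨_, rfl⟩
  have sf : Summable fun a : ℕ => leftsLaw (urnUp lam) (n + 1) a 0 * satur N a :=
    Summable.of_nonneg_of_le (fun a => mul_nonneg (hnn a) (satur_nonneg N a))
      (fun a => mul_le_mul_of_nonneg_left (satur_le N a) (hnn a)) (s0.mul_right (N : ℝ))
  have hs := ((s0.mul_left (satur N n - q * n)).add (s1.mul_left q)).sub (s2.mul_left (1 / (N : ℝ)))
  have hle : ∑' a : ℕ, ((satur N n - q * n) * leftsLaw (urnUp lam) (n + 1) a 0 +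
      q * (leftsLaw (urnUp lam) (n + 1) a 0 * a) -
      1 / (N : ℝ) * (leftsLaw (urnUp lam) (n + 1) a 0 * ((a : ℝ) - n) ^ 2)) ≤
      ∑' a : ℕ, leftsLaw (urnUp lam) (n + 1) a 0 * satur N a := by
    refine hs.tsum_le_tsum (fun a => ?_) sf
    have := mul_le_mul_of_nonneg_left (satur_sub_le hN n a) (hnn a)
    rw [← hq] at this
    refine le_trans (le_of_eq ?_) this
    ring
  rw [((s0.mul_left (satur N n - q * n)).add (s1.mul_left q)).tsum_sub (s2.mul_left (1 / (N : ℝ))),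
    (s0.mul_left (satur N n - q * n)).tsum_add (s1.mul_left q), tsum_mul_left, tsum_mul_left,
    tsum_mul_left, t0] at hle
  have e2 : 1 / (N : ℝ) * ∑' a : ℕ, leftsLaw (urnUp lam) (n + 1) a 0 * ((a : ℝ) - n) ^ 2 ≤
      C / N := by
    rw [one_div_mul_eq_div]
    exact div_le_div_of_nonneg_right hle2 hN'.le
  have e3 : (if n ≤ L then (∑' a : ℕ, leftsLaw (urnUp lam) (m + 1) a 0 * a - m) / 4 else 0) ≤
      q * (∑' a : ℕ, leftsLaw (urnUp lam) (n + 1) a 0 * a - n) := by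
    have hq0 : 0 ≤ q := hq ▸ sq_nonneg _
    split_ifs with hn
    · have hmn := hmin n (by simpa [Nat.lt_succ_iff] using hn)
      have hq1 : 1 / 4 ≤ q := by
        have hnN : (n : ℝ) ≤ N := by exact_mod_cast hn.trans hLN
        have : 1 / 2 ≤ (N : ℝ) / (N + n) := by
          rw [div_le_div_iff₀ (by norm_num) (by positivity)]; linarith
        rw [hq]; nlinarith
      have := mul_le_mul_of_nonneg_right hq1 (hd n).le
      linarith
    · exact mul_nonneg hq0 (hd n).le
  linarith

/-- The number of visits of `X` to `k` strictly before time `n`. -/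
def visits (X : ℕ → ℤ) (n : ℕ) (k : ℤ) : ℕ := Nat.count (fun i => X i = k) n

theorem visits_succ (X : ℕ → ℤ) (n : ℕ) (k : ℤ) :
    visits X (n + 1) k = visits X n k + if X n = k then 1 else 0 := Nat.count_succ _ _

/-- State (position, visit counts) of the walk which at its `(i+1)`-th visit to `k` steps to the
right if and only if `S k i` holds. -/
def stackState (S : ℤ → ℕ → Bool) : ℕ → ℤ × (ℤ → ℕ)
  | 0 => (0, fun _ => 0)
  | n + 1 =>
    (if S (stackState S n).1 ((stackState S n).2 (stackState S n).1) then (stackState S n).1 + 1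
      else (stackState S n).1 - 1,
    fun k => (stackState S n).2 k + if (stackState S n).1 = k then 1 else 0)

/-- The walk started at the origin and driven by the stacks of instructions `S`. -/
def stackWalk (S : ℤ → ℕ → Bool) (n : ℕ) : ℤ := (stackState S n).1

theorem stackState_snd (S : ℤ → ℕ → Bool) (n : ℕ) (k : ℤ) :
    (stackState S n).2 k = visits (stackWalk S) n k := by
  induction n with
  | zero => simp [stackState, visits]
  | succ n ih => rw [visits_succ, ← ih]; rfl

theorem stackWalk_zero (S : ℤ → ℕ → Bool) : stackWalk S 0 = 0 := rfl

theorem stackWalk_succ (S : ℤ → ℕ → Bool) (n : ℕ) :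
    stackWalk S (n + 1) =
      if S (stackWalk S n) (visits (stackWalk S) n (stackWalk S n)) then stackWalk S n + 1
      else stackWalk S n - 1 := by
  rw [← stackState_snd]; rfl

theorem stackWalk_step (S : ℤ → ℕ → Bool) (n : ℕ) :
    stackWalk S (n + 1) = stackWalk S n + 1 ∨ stackWalk S (n + 1) = stackWalk S n - 1 := by
  rw [stackWalk_succ]; split_ifs <;> simp

theorem edgePlus_succ (X : ℕ → ℤ) (n : ℕ) (k : ℤ) :
    edgePlus X (n + 1) k = edgePlus X n k + if X n = k ∧ X (n + 1) = k + 1 then 1 else 0 := by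
  unfold edgePlus
  rw [Finset.range_add_one, Finset.filter_insert]
  split_ifs <;> simp

theorem edgeMinus_succ (X : ℕ → ℤ) (n : ℕ) (k : ℤ) :
    edgeMinus X (n + 1) k = edgeMinus X n k + if X n = k ∧ X (n + 1) = k - 1 then 1 else 0 := by
  unfold edgeMinus
  rw [Finset.range_add_one, Finset.filter_insert]
  split_ifs <;> simp

theorem edgePlus_zero (X : ℕ → ℤ) (k : ℤ) : edgePlus X 0 k = 0 := rfl

theorem edgeMinus_zero (X : ℕ → ℤ) (k : ℤ) : edgeMinus X 0 k = 0 := rfl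

/-- Net flux through the edge `{k, k+1}` for a nearest-neighbour path started at the origin. -/
theorem edgePlus_sub_edgeMinus (X : ℕ → ℤ) (h0 : X 0 = 0) (n : ℕ)
    (h : ∀ i < n, X (i + 1) = X i + 1 ∨ X (i + 1) = X i - 1) (k : ℤ) :
    (edgePlus X n k : ℤ) - edgeMinus X n (k + 1) =
      (if 0 ≤ k ∧ k < X n then 1 else 0) - (if X n ≤ k ∧ k < 0 then 1 else 0) := by
  induction n with
  | zero =>
    rw [edgePlus_zero, edgeMinus_zero, h0]
    split_ifs <;> omega
  | succ n ih =>
    have ih' := ih fun i hi => h i (by omega)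
    have := h n (by omega)
    rw [edgePlus_succ, edgeMinus_succ]
    push_cast
    split_ifs at ih' ⊢ <;> omega

theorem edgePlus_add_edgeMinus (X : ℕ → ℤ) (n : ℕ)
    (h : ∀ i < n, X (i + 1) = X i + 1 ∨ X (i + 1) = X i - 1) (k : ℤ) :
    edgePlus X n k + edgeMinus X n k = visits X n k := by
  induction n with
  | zero => rfl
  | succ n ih =>
    have ih' := ih fun i hi => h i (by omega)
    have := h n (by omega)
    rw [edgePlus_succ, edgeMinus_succ, visits_succ, ← ih']
    split_ifs <;> omega

theorem edgePlus_stackWalk (S : ℤ → ℕ → Bool) (n : ℕ) (k : ℤ) :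
    edgePlus (stackWalk S) n k =
      Nat.count (fun i => S k i = true) (visits (stackWalk S) n k) := by
  induction n with
  | zero => rfl
  | succ n ih =>
    rw [edgePlus_succ, visits_succ, ih]
    by_cases hk : stackWalk S n = k
    · rw [if_pos hk, Nat.count_succ, stackWalk_succ, hk]
      by_cases hS : S k (visits (stackWalk S) n k) = true
      · simp [hS]
      · simp only [hS, Bool.false_eq_true, if_false, true_and]
        rw [if_neg (by omega)]
    · simp [hk]

theorem locTime_eq_visits (X : ℕ → ℤ) (n : ℕ) (k : ℤ) : locTime X n k = visits X (n + 1) k := by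
  rw [locTime, visits, Nat.count_eq_card_filter_range]

theorem invLocTime_eq_nth (X : ℕ → ℤ) (k : ℤ) (m : ℕ) (h : {i | X i = k}.Infinite) :
    invLocTime X k m = Nat.nth (fun i => X i = k) m := by
  have h' : (Set.ofPred fun i => X i = k).Infinite := h
  have hmem : m < locTime X (Nat.nth (fun i => X i = k) m) k := by
    rw [locTime_eq_visits, visits, Nat.count_nth_succ_of_infinite h']
    exact Nat.lt_succ_self m
  refine le_antisymm (Nat.sInf_le hmem) (le_csInf ⟨_, hmem⟩ fun n hn => ?_)
  have hn' : m < visits X (n + 1) k := by rw [← locTime_eq_visits]; exact hn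
  exact Nat.lt_succ_iff.1 (Nat.nth_lt_of_lt_count hn')

theorem edgePlus_invLocTime (S : ℤ → ℕ → Bool) (k : ℤ) (m : ℕ)
    (h : {i | stackWalk S i = k}.Infinite) :
    edgePlus (stackWalk S) (invLocTime (stackWalk S) k m) k =
      Nat.count (fun i => S k i = true) m := by
  rw [edgePlus_stackWalk, invLocTime_eq_nth _ _ _ h, visits, Nat.count_nth_of_infinite h]

theorem exists_lt_locTime (X : ℕ → ℤ) (k : ℤ) (m : ℕ) (h : {i | X i = k}.Infinite) :
    ∃ n, m < locTime X n k := by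
  refine ⟨Nat.nth (fun i => X i = k) m, ?_⟩
  rw [locTime_eq_visits, visits, Nat.count_nth_succ_of_infinite h]
  exact Nat.lt_succ_self m

theorem infinite_visits_of_stack {S : ℤ → ℕ → Bool} {k l : ℤ}
    (hk : {i | stackWalk S i = k}.Infinite) {b : Bool} (hS : {i | S k i = b}.Infinite)
    (hl : l = if b then k + 1 else k - 1) : {i | stackWalk S i = l}.Infinite := by
  intro hfin
  obtain ⟨B, hB⟩ := hfin.bddAbove
  obtain ⟨i, hi, hiB⟩ := hS.exists_gt (visits (stackWalk S) (B + 1) k)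
  have hnk : stackWalk S (Nat.nth (fun i => stackWalk S i = k) i) = k :=
    Nat.nth_mem_of_infinite (p := fun i => stackWalk S i = k) hk i
  have hv : visits (stackWalk S) (Nat.nth (fun i => stackWalk S i = k) i) k = i :=
    Nat.count_nth_of_infinite hk i
  obtain ⟨n, hn⟩ : ∃ n, n = Nat.nth (fun i => stackWalk S i = k) i := ⟨_, rfl⟩
  rw [← hn] at hnk hv
  have hstep := stackWalk_succ S n
  rw [hnk, hv, show S k i = b from hi, ← hl] at hstep
  have h1 : n + 1 ≤ B := hB hstep
  have h2 : visits (stackWalk S) n k ≤ visits (stackWalk S) (B + 1) k :=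
    Nat.count_monotone _ (by omega)
  omega

/-- All stacks contain infinitely many instructions of both kinds. -/
def GoodStacks (S : ℤ → ℕ → Bool) : Prop := ∀ k b, {i | S k i = b}.Infinite

theorem infinite_visits_all {S : ℤ → ℕ → Bool} (hS : GoodStacks S) {k : ℤ}
    (hk : {i | stackWalk S i = k}.Infinite) (l : ℤ) : {i | stackWalk S i = l}.Infinite := by
  induction l using Int.inductionOn' (b := k) with
  | zero => exact hk
  | succ l _ ih => exact infinite_visits_of_stack ih (hS l true) rfl
  | pred l _ ih => exact infinite_visits_of_stack ih (hS l false) rfl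

theorem tendsto_atTop_of_finite_visits {X : ℕ → ℤ}
    (h : ∀ n, X (n + 1) = X n + 1 ∨ X (n + 1) = X n - 1) (hf : ∀ k, {i | X i = k}.Finite) :
    Filter.Tendsto X Filter.atTop Filter.atTop ∨ Filter.Tendsto X Filter.atTop Filter.atBot := by
  have hne : ∀ k, ∀ᶠ n in Filter.atTop, X n ≠ k := by
    intro k
    obtain ⟨B, hB⟩ := (hf k).bddAbove
    filter_upwards [Filter.eventually_gt_atTop B] with n hn he
    exact absurd (hB he) (by omega)
  have hfin : ∀ a b : ℤ, ∀ᶠ n in Filter.atTop, X n ∉ Set.Icc a b := by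
    intro a b
    have := (Filter.eventually_all_finite (Set.finite_Icc a b)).2 fun k _ => hne k
    filter_upwards [this] with n hn hm
    exact hn _ hm rfl
  obtain ⟨N, hN⟩ := Filter.eventually_atTop.1 (hne 0)
  rcases lt_or_gt_of_ne (hN N le_rfl) with h0 | h0
  · right
    have hs : ∀ n, N ≤ n → X n < 0 := by
      intro n hn
      induction n, hn using Nat.le_induction with
      | base => exact h0
      | succ n hn ih =>
        have a1 := hN (n + 1) (by omega)
        have a2 := h n
        omega
    refine Filter.tendsto_atBot.2 fun b => ?_
    filter_upwards [hfin b 0, Filter.eventually_ge_atTop N] with n h1 h2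
    have h3 := hs n h2
    simp only [Set.mem_Icc, not_and_or] at h1
    omega
  · left
    have hs : ∀ n, N ≤ n → 0 < X n := by
      intro n hn
      induction n, hn using Nat.le_induction with
      | base => exact h0
      | succ n hn ih =>
        have a1 := hN (n + 1) (by omega)
        have a2 := h n
        omega
    refine Filter.tendsto_atTop.2 fun b => ?_
    filter_upwards [hfin 0 b, Filter.eventually_ge_atTop N] with n h1 h2
    have h3 := hs n h2
    simp only [Set.mem_Icc, not_and_or] at h1
    omega

theorem recurrent_or_transient {S : ℤ → ℕ → Bool} (hS : GoodStacks S) :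
    (∀ k, {i | stackWalk S i = k}.Infinite) ∨
      Filter.Tendsto (stackWalk S) Filter.atTop Filter.atTop ∨
      Filter.Tendsto (stackWalk S) Filter.atTop Filter.atBot := by
  by_cases h : ∃ k, {i | stackWalk S i = k}.Infinite
  · obtain ⟨k, hk⟩ := h
    exact Or.inl (infinite_visits_all hS hk)
  · push Not at h
    exact Or.inr (tendsto_atTop_of_finite_visits (stackWalk_step S) h)

theorem stack_last_exit (S : ℤ → ℕ → Bool) (n : ℕ) (k : ℤ)
    (hv : visits (stackWalk S) n k ≠ 0) (hk : k < stackWalk S n) :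
    S k (visits (stackWalk S) n k - 1) = true := by
  induction n with
  | zero => exact absurd rfl hv
  | succ n ih =>
    rw [visits_succ] at hv ⊢
    by_cases he : stackWalk S n = k
    · rw [if_pos he, Nat.add_sub_cancel]
      by_contra hS
      rw [stackWalk_succ, he, if_neg hS] at hk
      omega
    · rw [if_neg he, add_zero] at hv ⊢
      have := stackWalk_step S n
      exact ih hv (by omega)

/-- The number of left instructions before the `(n+1)`-th right instruction. -/
def leftsBefore (s : ℕ → Bool) (n : ℕ) : ℕ := Nat.nth (fun i => s i = true) n - n

/-- Numbers of left steps from the sites `K, K-1, K-2, …` before the first visit to `K`,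
expressed through the stacks. -/
def leftsProfile (S : ℤ → ℕ → Bool) (K : ℕ) : ℕ → ℕ
  | 0 => 0
  | j + 1 => leftsBefore (S (K - 1 - j)) (leftsProfile S K j)

theorem edgeMinus_first_hit (S : ℤ → ℕ → Bool) (K n : ℕ) (hn : stackWalk S n = K)
    (hn' : ∀ i < n, stackWalk S i ≠ K) (j : ℕ) (hj : j + 1 ≤ K) :
    edgeMinus (stackWalk S) n (K - j) = leftsProfile S K j := by
  induction j with
  | zero =>
    rw [edgeMinus, leftsProfile, Finset.card_eq_zero, Finset.filter_eq_empty_iff]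
    intro i hi h
    exact hn' i (Finset.mem_range.1 hi) (by simpa using h.1)
  | succ j ih =>
    have ih' := ih (by omega)
    obtain ⟨k, hk⟩ : ∃ k : ℤ, k = K - 1 - j := ⟨_, rfl⟩
    have e1 : (K : ℤ) - ((j + 1 : ℕ) : ℤ) = k := by push_cast; omega
    have e2 : (K : ℤ) - j = k + 1 := by omega
    have hflux := edgePlus_sub_edgeMinus (stackWalk S) (stackWalk_zero S) n
      (fun i _ => stackWalk_step S i) k
    rw [e2] at ih'
    rw [if_pos ⟨by omega, by omega⟩, if_neg (by omega), ih'] at hflux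
    have hadd := edgePlus_add_edgeMinus (stackWalk S) n (fun i _ => stackWalk_step S i) k
    have hcount := edgePlus_stackWalk S n k
    have hv : visits (stackWalk S) n k ≠ 0 := by omega
    have hlast := stack_last_exit S n k hv (by omega)
    obtain ⟨V, hV⟩ := Nat.exists_eq_succ_of_ne_zero hv
    rw [hV, Nat.succ_sub_one] at hlast
    rw [hV, Nat.succ_eq_add_one, Nat.count_succ, if_pos hlast] at hcount
    have hnth := Nat.nth_count (p := fun i => S k i = true) hlast
    have hz : Nat.count (fun i => S k i = true) V = leftsProfile S K j := by omega
    rw [hz] at hnth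
    rw [e1, leftsProfile, leftsBefore, ← hk, hnth]
    omega

theorem leftsProfile_bounded {S : ℤ → ℕ → Bool}
    (h : Filter.Tendsto (stackWalk S) Filter.atTop Filter.atTop) :
    ∃ L, ∀ K, leftsProfile S (K + 1) K ≤ L := by
  obtain ⟨L, hL⟩ := Filter.eventually_atTop.1 (h.eventually_gt_atTop 1)
  refine ⟨L, fun K => ?_⟩
  have hex : ∃ n, ((K + 1 : ℕ) : ℤ) ≤ stackWalk S n :=
    (h.eventually_ge_atTop _).exists
  classical
  have h1 := Nat.find_spec hex
  have h2 := fun i (hi : i < Nat.find hex) => not_le.1 (Nat.find_min hex hi)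
  obtain ⟨n, hn⟩ : ∃ n, n = Nat.find hex := ⟨_, rfl⟩
  rw [← hn] at h1
  have h2' : ∀ i < n, stackWalk S i < ((K + 1 : ℕ) : ℤ) := fun i hi => h2 i (hn ▸ hi)
  have h3 : stackWalk S n = ((K + 1 : ℕ) : ℤ) := by
    cases n with
    | zero => rw [stackWalk_zero] at h1; omega
    | succ n =>
      have a1 := h2' n (by omega)
      have a2 := stackWalk_step S n
      omega
  rw [← edgeMinus_first_hit S (K + 1) n h3 (fun i hi => (h2' i hi).ne) K le_rfl,
    show ((K + 1 : ℕ) : ℤ) - K = 1 by push_cast; ring, edgeMinus]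
  calc _ ≤ (Finset.range L).card := Finset.card_le_card fun i hi => by
        have hi' := (Finset.mem_filter.1 hi).2.1
        by_contra hc
        have := hL i (by simpa using hc)
        omega
    _ = L := Finset.card_range L

theorem measure_ext_of_cylinder {P Q : Measure (ℕ → ℤ)} [IsProbabilityMeasure Q]
    (h : ∀ (n : ℕ) (p : ℕ → ℤ), P {ω | ∀ i ≤ n, ω i = p i} = Q {ω | ∀ i ≤ n, ω i = p i}) :
    P = Q := by
  have hQ : IsProjectiveLimit Q fun I : Finset ℕ => Q.map I.restrict := fun I => rfl
  have hfam : IsProjectiveMeasureFamily fun I : Finset ℕ => Q.map I.restrict := by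
    intro I J hJI
    simp only
    rw [Measure.map_map (by fun_prop) (by fun_prop)]
    rfl
  have hf : ∀ I : Finset ℕ, IsFiniteMeasure (Q.map I.restrict) := fun I => inferInstance
  have hP : IsProjectiveLimit P fun I : Finset ℕ => Q.map I.restrict := by
    refine (isProjectiveLimit_nat_iff hfam P).2 fun n => ?_
    refine Measure.ext_of_singleton fun a => ?_
    have hpre : (Preorder.frestrictLe n : (ℕ → ℤ) → _) ⁻¹' {a} =
        {ω | ∀ i ≤ n, ω i = if hi : i ≤ n then a ⟨i, Finset.mem_Iic.2 hi⟩ else 0} := by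
      ext ω
      simp only [Set.mem_preimage, Set.mem_singleton_iff, Set.mem_ofPred_eq, funext_iff]
      constructor
      · intro h i hi
        rw [dif_pos hi]
        exact h ⟨i, Finset.mem_Iic.2 hi⟩
      · rintro h ⟨i, hi⟩
        have := h i (Finset.mem_Iic.1 hi)
        rw [dif_pos (Finset.mem_Iic.1 hi)] at this
        exact this
    rw [Measure.map_apply (by fun_prop) (measurableSet_singleton a),
      Measure.map_apply (by fun_prop) (measurableSet_singleton a)]
    change P ((Preorder.frestrictLe n : (ℕ → ℤ) → _) ⁻¹' {a}) =
      Q ((Preorder.frestrictLe n : (ℕ → ℤ) → _) ⁻¹' {a})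
    rw [hpre]
    exact h n _
  exact hP.unique hQ

/-- The uniform distribution on `[0, 1]`. -/
def unif : Measure ℝ := volume.restrict (Set.Icc 0 1)

instance : IsProbabilityMeasure unif := ⟨by simp [unif]⟩

theorem unif_lt {p : ℝ} (h1 : p ≤ 1) : unif {u | u < p} = ENNReal.ofReal p := by
  have hm : MeasurableSet {u : ℝ | u < p} := measurableSet_Iio
  rw [unif, Measure.restrict_apply hm]
  have : {u : ℝ | u < p} ∩ Set.Icc 0 1 = Set.Ico 0 p := by
    ext u
    simp only [Set.mem_inter_iff, Set.mem_ofPred_eq, Set.mem_Icc, Set.mem_Ico]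
    constructor
    · rintro ⟨a, b, c⟩; exact ⟨b, a⟩
    · rintro ⟨a, b⟩; exact ⟨b, a, by linarith⟩
  rw [this, Real.volume_Ico, sub_zero]

theorem unif_not_lt {p : ℝ} (h0 : 0 ≤ p) (h1 : p ≤ 1) :
    unif {u | ¬u < p} = ENNReal.ofReal (1 - p) := by
  change unif {u | u < p}ᶜ = _
  have hm : MeasurableSet {u : ℝ | u < p} := measurableSet_Iio
  rw [prob_compl_eq_one_sub hm, unif_lt h1, ENNReal.ofReal_sub _ h0,
    ENNReal.ofReal_one]

/-- The law of the uniform variables attached to a site. -/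
def siteMeasure : Measure (ℕ → ℝ) := Measure.infinitePi fun _ => unif

/-- The law of independent uniform variables attached to all sites. -/
def stackMeasure : Measure (ℤ → ℕ → ℝ) := Measure.infinitePi fun _ => siteMeasure

instance : IsProbabilityMeasure siteMeasure := by unfold siteMeasure; infer_instance

instance : IsProbabilityMeasure stackMeasure := by unfold stackMeasure; infer_instance

theorem stackMeasure_box {n : ℕ} {idx : Fin n → ℤ × ℕ} (hidx : Function.Injective idx)
    {I : Fin n → Set ℝ} (hI : ∀ i, MeasurableSet (I i)) :
    stackMeasure {ω | ∀ i, ω (idx i).1 (idx i).2 ∈ I i} = ∏ i, unif (I i) := by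
  have h1 : stackMeasure = (Measure.infinitePi fun _ : ℤ × ℕ => unif).map
      (MeasurableEquiv.curry ℤ ℕ ℝ) :=
    (Measure.infinitePi_map_curry (fun (_ : ℤ) (_ : ℕ) => unif)).symm
  have h2 := Measure.map_infinitePi_infinitePi_of_inj (P := fun _ : ℤ × ℕ => unif) hidx
  have h3 : MeasurableSet {ω : ℤ → ℕ → ℝ | ∀ i, ω (idx i).1 (idx i).2 ∈ I i} := by
    rw [Set.ofPred_forall]
    exact MeasurableSet.iInter fun i =>
      (by fun_prop : Measurable fun ω : ℤ → ℕ → ℝ => ω (idx i).1 (idx i).2) (hI i)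
  rw [h1, Measure.map_apply (MeasurableEquiv.measurable _) h3]
  have h4 : (MeasurableEquiv.curry ℤ ℕ ℝ) ⁻¹' {ω | ∀ i, ω (idx i).1 (idx i).2 ∈ I i} =
      (fun (x : ℤ × ℕ → ℝ) i => x (idx i)) ⁻¹' (Set.univ.pi I) := by
    ext x; simp [MeasurableEquiv.coe_curry, Function.curry]
  rw [h4, ← Measure.map_apply (by fun_prop) (MeasurableSet.univ_pi hI), h2]
  rw [Measure.infinitePi_eq_pi, Measure.pi_pi]

/-- Joint law of finitely many distinct steps decided by the uniform variables. -/
theorem stackMeasure_steps (n : ℕ) (idx : ℕ → ℤ × ℕ)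
    (hidx : ∀ i < n, ∀ j < n, idx i = idx j → i = j) (thr : ℕ → ℝ) (h0 : ∀ i, 0 ≤ thr i)
    (h1 : ∀ i, thr i ≤ 1) (p : ℕ → ℤ) :
    (stackMeasure {ω | ∀ i < n, p (i + 1) =
      if ω (idx i).1 (idx i).2 < thr i then p i + 1 else p i - 1}).toReal =
    ∏ i ∈ Finset.range n, if p (i + 1) = p i + 1 then thr i
      else if p (i + 1) = p i - 1 then 1 - thr i else 0 := by
  have hI : ∀ i : ℕ, MeasurableSet {u : ℝ | p (i + 1) = if u < thr i then p i + 1 else p i - 1} :=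
    fun i => measurableSet_eq_fun measurable_const
      (Measurable.ite measurableSet_Iio measurable_const measurable_const)
  have hbox := stackMeasure_box (n := n) (idx := fun i => idx i)
    (fun i j h => Fin.ext (hidx i i.2 j j.2 h))
    (I := fun i => {u : ℝ | p (i + 1) = if u < thr i then p i + 1 else p i - 1}) (fun i => hI i)
  have hset : {ω : ℤ → ℕ → ℝ | ∀ i < n, p (i + 1) =
      if ω (idx i).1 (idx i).2 < thr i then p i + 1 else p i - 1} =
      {ω | ∀ i : Fin n, ω (idx i).1 (idx i).2 ∈
        {u : ℝ | p (i + 1) = if u < thr i then p i + 1 else p i - 1}} := by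
    ext ω
    exact ⟨fun h i => h i i.2, fun h i hi => h ⟨i, hi⟩⟩
  rw [hset, hbox, ENNReal.toReal_prod, Fin.prod_univ_eq_prod_range
    (fun i => (unif {u : ℝ | p (i + 1) = if u < thr i then p i + 1 else p i - 1}).toReal)]
  refine Finset.prod_congr rfl fun i _ => ?_
  by_cases hu : p (i + 1) = p i + 1
  · have : {u : ℝ | p (i + 1) = if u < thr i then p i + 1 else p i - 1} = {u | u < thr i} := by
      ext u
      simp only [Set.mem_ofPred_eq]
      split_ifs with h
      · simp [hu, h]
      · simp only [h, iff_false]; omega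
    rw [this, unif_lt (h1 i), if_pos hu, ENNReal.toReal_ofReal (h0 i)]
  · rw [if_neg hu]
    by_cases hd : p (i + 1) = p i - 1
    · have : {u : ℝ | p (i + 1) = if u < thr i then p i + 1 else p i - 1} = {u | ¬u < thr i} := by
        ext u
        simp only [Set.mem_ofPred_eq]
        split_ifs with h
        · simp only [h, not_true, iff_false]; omega
        · simp [hd, h]
      rw [this, unif_not_lt (h0 i) (h1 i), if_pos hd,
        ENNReal.toReal_ofReal (by linarith [h1 i])]
    · have : {u : ℝ | p (i + 1) = if u < thr i then p i + 1 else p i - 1} = ∅ := by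
        ext u
        simp only [Set.mem_ofPred_eq, Set.mem_empty_iff_false, iff_false]
        split_ifs <;> omega
      rw [this, if_neg hd]
      simp

/-- A function of finitely many coordinates of a product space is independent of any other
coordinate. -/
theorem indepFun_eval_of_dependsOn {ι X α : Type*} [MeasurableSpace X] [MeasurableSpace α]
    [DecidableEq ι] (ν : Measure X) [IsProbabilityMeasure ν] (T : Finset ι) {i : ι} (hi : i ∉ T)
    {f : (ι → X) → α} (hf : Measurable f) (hdep : DependsOn f T) :
    ProbabilityTheory.IndepFun f (fun ω => ω i) (Measure.infinitePi fun _ : ι => ν) := by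
  obtain ⟨x0⟩ : Nonempty X := nonempty_of_isProbabilityMeasure ν
  have hind : ProbabilityTheory.iIndepFun (fun (j : ι) (ω : ι → X) => ω j)
      (Measure.infinitePi fun _ : ι => ν) :=
    ProbabilityTheory.iIndepFun_infinitePi (X := fun _ (x : X) => x) fun _ => measurable_id
  have h := hind.indepFun_finset T {i} (by simpa using hi) (fun j => measurable_pi_apply j)
  have hext : Measurable fun (y : T → X) (j : ι) => if hj : j ∈ T then y ⟨j, hj⟩ else x0 := by
    refine measurable_pi_lambda _ fun j => ?_
    by_cases hj : j ∈ T
    · simp only [hj, dif_pos]; fun_prop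
    · simp only [hj, dif_neg, not_false_eq_true]; fun_prop
  have h2 := h.comp (hf.comp hext)
    (measurable_pi_apply (⟨i, Finset.mem_singleton_self i⟩ : ({i} : Finset ι)))
  convert h2 using 1
  · ext ω
    refine hdep fun j hj => ?_
    have hj' : j ∈ T := hj
    simp [hj']
  · rfl

/-- Up-probabilities of the modified urn discrepancy chain. -/
def tildeUp (lam : ℝ) (w : ℤ) : ℝ := lam ^ (2 * w) / (1 + lam ^ (2 * w))

theorem tildeUp_pos {lam : ℝ} (h0 : 0 < lam) (w : ℤ) : 0 < tildeUp lam w := by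
  unfold tildeUp; positivity

theorem one_sub_tildeUp {lam : ℝ} (h0 : 0 < lam) (w : ℤ) :
    1 - tildeUp lam w = 1 / (1 + lam ^ (2 * w)) := by
  unfold tildeUp
  have : 0 < lam ^ (2 * w) := by positivity
  field_simp
  ring

theorem tildeUp_lt_one {lam : ℝ} (h0 : 0 < lam) (w : ℤ) : tildeUp lam w < 1 := by
  have h := one_sub_tildeUp h0 w
  have : 0 < 1 / (1 + lam ^ (2 * w)) := by positivity
  linarith

theorem half_le_tildeUp {lam : ℝ} (h0 : 0 < lam) (h1 : lam < 1) (w : ℤ) (hw : w ≤ 0) :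
    1 / 2 ≤ tildeUp lam w := by
  have h : 1 ≤ lam ^ (2 * w) := one_le_zpow_of_nonpos₀ h0 h1.le (by omega)
  rw [tildeUp, div_le_div_iff₀ (by norm_num) (by positivity)]
  linarith

theorem tildeUp_le_half {lam : ℝ} (h0 : 0 < lam) (h1 : lam < 1) (w : ℤ) (hw : 0 ≤ w) :
    tildeUp lam w ≤ 1 / 2 := by
  have h : lam ^ (2 * w) ≤ 1 := zpow_le_one₀ h0 h1.le (by omega)
  rw [tildeUp, div_le_div_iff₀ (by positivity) (by norm_num)]
  linarith

/-- Up-probabilities of the discrepancy chain attached to the site `k`. -/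
def sitePr (lam : ℝ) (k : ℤ) : ℤ → ℝ := if k = 0 then tildeUp lam else urnUp lam

/-- Starting point of the discrepancy chain attached to the site `k`. -/
def siteStart (k : ℤ) : ℤ := if k ≤ -1 then 1 else 0

theorem sitePr_pos {lam : ℝ} (h0 : 0 < lam) (k w : ℤ) : 0 < sitePr lam k w := by
  unfold sitePr; split_ifs
  exacts [tildeUp_pos h0 w, urnUp_pos h0 w]

theorem sitePr_lt_one {lam : ℝ} (h0 : 0 < lam) (k w : ℤ) : sitePr lam k w < 1 := by
  unfold sitePr; split_ifs
  exacts [tildeUp_lt_one h0 w, urnUp_lt_one h0 w]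

theorem half_le_sitePr {lam : ℝ} (h0 : 0 < lam) (h1 : lam < 1) (k w : ℤ) (hw : w ≤ 0) :
    1 / 2 ≤ sitePr lam k w := by
  unfold sitePr; split_ifs
  exacts [half_le_tildeUp h0 h1 w hw, half_le_urnUp h0 h1 w hw]

theorem sitePr_le_half {lam : ℝ} (h0 : 0 < lam) (h1 : lam < 1) (k w : ℤ) (hw : 1 ≤ w) :
    sitePr lam k w ≤ 1 / 2 := by
  unfold sitePr; split_ifs
  exacts [tildeUp_le_half h0 h1 w (by omega), urnUp_le_half h0 h1 w hw]

/-- The nearest-neighbour path with up-probabilities `pr` started at `d` and driven by the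
numbers `u 0, u 1, …`. -/
def urnPath (pr : ℤ → ℝ) (d : ℤ) (u : ℕ → ℝ) : ℕ → ℤ
  | 0 => d
  | i + 1 => if u i < pr (urnPath pr d u i) then urnPath pr d u i + 1 else urnPath pr d u i - 1

/-- Whether the path `urnPath` makes an up-step at time `i`. -/
def urnBit (pr : ℤ → ℝ) (d : ℤ) (u : ℕ → ℝ) (i : ℕ) : Bool := decide (u i < pr (urnPath pr d u i))

theorem urnPath_eq (pr : ℤ → ℝ) (d : ℤ) (u : ℕ → ℝ) (i : ℕ) :
    urnPath pr d u i = d + 2 * (Nat.count (fun i => urnBit pr d u i = true) i : ℤ) - i := by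
  induction i with
  | zero => simp [urnPath]
  | succ i ih =>
    rw [urnPath, Nat.count_succ]
    by_cases h : u i < pr (urnPath pr d u i)
    · have h' : urnBit pr d u i = true := by simpa [urnBit] using h
      rw [if_pos h, if_pos h', ih]; push_cast; ring
    · have h' : ¬urnBit pr d u i = true := by simpa [urnBit] using h
      rw [if_neg h, if_neg h', ih]; push_cast; ring

theorem urnPath_forall_eq_iff (pr : ℤ → ℝ) (d : ℤ) (u : ℕ → ℝ) (n : ℕ) (p : ℕ → ℤ) :
    (∀ i ≤ n, urnPath pr d u i = p i) ↔
      p 0 = d ∧ ∀ i < n, p (i + 1) = if u i < pr (p i) then p i + 1 else p i - 1 := by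
  constructor
  · intro h
    refine ⟨(h 0 (Nat.zero_le _)).symm, fun i hi => ?_⟩
    rw [← h i hi.le, ← h (i + 1) hi, urnPath]
  · rintro ⟨h0, h⟩ i hi
    induction i with
    | zero => exact h0.symm
    | succ i ih => rw [urnPath, ih (by omega), h i hi]

theorem measurable_urnPath (pr : ℤ → ℝ) (d : ℤ) (i : ℕ) :
    Measurable fun u : ℕ → ℝ => urnPath pr d u i := by
  induction i with
  | zero => exact measurable_const
  | succ i ih =>
    simp only [urnPath]
    exact Measurable.ite (measurableSet_lt (measurable_pi_apply i)
      ((Measurable.of_discrete (f := pr)).comp ih)) (ih.add_const 1) (ih.sub_const 1)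

theorem measurable_urnBit (pr : ℤ → ℝ) (d : ℤ) :
    Measurable (urnBit pr d) := by
  refine measurable_pi_lambda _ fun i => ?_
  have : MeasurableSet {u : ℕ → ℝ | u i < pr (urnPath pr d u i)} :=
    measurableSet_lt (measurable_pi_apply i)
      ((Measurable.of_discrete (f := pr)).comp (measurable_urnPath pr d i))
  exact measurable_to_bool (by
    convert this using 1
    ext u
    simp [urnBit])

/-- The path attached to a site is a Markov chain with up-probabilities `pr`. -/
theorem map_urnPath {pr : ℤ → ℝ} (h0 : ∀ w, 0 ≤ pr w) (h1 : ∀ w, pr w ≤ 1) (d k : ℤ)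
    (Q : Measure (ℕ → ℤ)) [IsProbabilityMeasure Q]
    (hQ : ∀ (n : ℕ) (p : ℕ → ℤ), (Q {ω | ∀ i ≤ n, ω i = p i}).toReal =
      (if p 0 = d then (1 : ℝ) else 0) * ∏ i ∈ Finset.range n,
        if p (i + 1) = p i + 1 then pr (p i) else if p (i + 1) = p i - 1 then 1 - pr (p i) else 0) :
    stackMeasure.map (fun ω => urnPath pr d (ω k)) = Q := by
  have hm : Measurable fun ω : ℤ → ℕ → ℝ => urnPath pr d (ω k) :=
    (measurable_pi_lambda _ fun i => measurable_urnPath pr d i).comp (measurable_pi_apply k)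
  have := Measure.isProbabilityMeasure_map (μ := stackMeasure) hm.aemeasurable
  refine measure_ext_of_cylinder fun n p => ?_
  rw [← ENNReal.toReal_eq_toReal_iff' (measure_ne_top _ _) (measure_ne_top _ _), hQ]
  have hc : MeasurableSet {ω : ℕ → ℤ | ∀ i ≤ n, ω i = p i} := by
    simp only [Set.ofPred_forall]
    exact MeasurableSet.iInter fun i => MeasurableSet.iInter fun _ =>
      measurableSet_eq_fun (measurable_pi_apply i) measurable_const
  rw [Measure.map_apply hm hc]
  simp only [Set.preimage_ofPred_eq, urnPath_forall_eq_iff]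
  by_cases hp : p 0 = d
  · simp only [hp, true_and, if_true, one_mul]
    exact stackMeasure_steps n (fun i => (k, i)) (fun i _ j _ h => (Prod.mk.inj h).2)
      (fun i => pr (p i)) (fun i => h0 _) (fun i => h1 _) p
  · simp [hp]

/-- The instructions at all sites. -/
def urnStack (lam : ℝ) (ω : ℤ → ℕ → ℝ) (k : ℤ) : ℕ → Bool :=
  urnBit (sitePr lam k) (siteStart k) (ω k)

theorem measurable_urnStack (lam : ℝ) : Measurable (urnStack lam) :=
  measurable_pi_lambda _ fun k => (measurable_urnBit _ _).comp (measurable_pi_apply k)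

theorem measurable_stackWalk : Measurable stackWalk := by
  refine measurable_pi_lambda _ fun n => ?_
  suffices h : Measurable (fun S => stackWalk S n) ∧
      ∀ k, Measurable fun S => visits (stackWalk S) n k from h.1
  induction n with
  | zero => exact ⟨measurable_const, fun k => measurable_const⟩
  | succ n ih =>
    obtain ⟨ih1, ih2⟩ := ih
    refine ⟨?_, fun k => ?_⟩
    · simp only [stackWalk_succ]
      have hv : Measurable fun S => visits (stackWalk S) n (stackWalk S n) :=
        (measurable_from_prod_countable_left (f := fun q : (ℤ → ℕ → Bool) × ℤ =>
          visits (stackWalk q.1) n q.2) ih2).comp (measurable_id.prodMk ih1)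
      have hS : Measurable fun S : ℤ → ℕ → Bool =>
          S (stackWalk S n) (visits (stackWalk S) n (stackWalk S n)) :=
        (measurable_from_prod_countable_left (f := fun q : (ℤ → ℕ → Bool) × (ℤ × ℕ) =>
          q.1 q.2.1 q.2.2) (fun q => by dsimp only; fun_prop)).comp
          (measurable_id.prodMk (ih1.prodMk hv))
      exact Measurable.ite (hS (measurableSet_singleton true)) (ih1.add_const 1) (ih1.sub_const 1)
    · simp only [visits_succ]
      exact (ih2 k).add (Measurable.ite (ih1 (measurableSet_singleton k)) measurable_const
        measurable_const)

theorem visits_congr {X Y : ℕ → ℤ} {n : ℕ} (h : ∀ i < n, X i = Y i) (k : ℤ) :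
    visits X n k = visits Y n k := by
  unfold visits
  rw [Nat.count_eq_card_filter_range, Nat.count_eq_card_filter_range]
  exact congrArg _ (Finset.filter_congr fun i hi => by rw [h i (Finset.mem_range.1 hi)])

theorem edgePlus_congr {X Y : ℕ → ℤ} {n : ℕ} (h : ∀ i ≤ n, X i = Y i) (k : ℤ) :
    edgePlus X n k = edgePlus Y n k :=
  congrArg _ (Finset.filter_congr fun i hi => by
    have := Finset.mem_range.1 hi
    rw [h i (by omega), h (i + 1) this])

theorem edgeMinus_congr {X Y : ℕ → ℤ} {n : ℕ} (h : ∀ i ≤ n, X i = Y i) (k : ℤ) :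
    edgeMinus X n k = edgeMinus Y n k :=
  congrArg _ (Finset.filter_congr fun i hi => by
    have := Finset.mem_range.1 hi
    rw [h i (by omega), h (i + 1) this])

/-- The probability of a step to the right at time `n`, expressed through the discrepancy between
right and left steps from the current site. -/
def rightProb (lam : ℝ) (X : ℕ → ℤ) (n : ℕ) : ℝ :=
  sitePr lam (X n) (siteStart (X n) + edgePlus X n (X n) - edgeMinus X n (X n))

theorem rightProb_congr (lam : ℝ) {X Y : ℕ → ℤ} {n : ℕ} (h : ∀ i ≤ n, X i = Y i) :
    rightProb lam X n = rightProb lam Y n := by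
  unfold rightProb
  rw [edgePlus_congr h, edgeMinus_congr h, h n le_rfl]

theorem stackWalk_urnStack_succ (lam : ℝ) (ω : ℤ → ℕ → ℝ) (n : ℕ) :
    stackWalk (urnStack lam ω) (n + 1) =
      if ω (stackWalk (urnStack lam ω) n)
          (visits (stackWalk (urnStack lam ω)) n (stackWalk (urnStack lam ω) n)) <
        rightProb lam (stackWalk (urnStack lam ω)) n
      then stackWalk (urnStack lam ω) n + 1 else stackWalk (urnStack lam ω) n - 1 := by
  rw [stackWalk_succ, rightProb]
  set X := stackWalk (urnStack lam ω) with hX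
  have h1 : ((edgePlus X n (X n) : ℕ) : ℤ) =
      Nat.count (fun i => urnStack lam ω (X n) i = true) (visits X n (X n)) := by
    rw [hX, edgePlus_stackWalk]
  have h2 : ((edgePlus X n (X n) + edgeMinus X n (X n) : ℕ) : ℤ) = visits X n (X n) :=
    congrArg _ (edgePlus_add_edgeMinus X n (fun i _ => stackWalk_step _ i) (X n))
  have h3 := urnPath_eq (sitePr lam (X n)) (siteStart (X n)) (ω (X n)) (visits X n (X n))
  have h4 : siteStart (X n) + edgePlus X n (X n) - edgeMinus X n (X n) =
      urnPath (sitePr lam (X n)) (siteStart (X n)) (ω (X n)) (visits X n (X n)) := by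
    rw [h3]
    unfold urnStack at h1
    push_cast at h2
    omega
  rw [h4]
  simp only [urnStack, urnBit, decide_eq_true_eq]

theorem stackWalk_forall_eq_iff (lam : ℝ) (ω : ℤ → ℕ → ℝ) (n : ℕ) (p : ℕ → ℤ) :
    (∀ i ≤ n, stackWalk (urnStack lam ω) i = p i) ↔
      p 0 = 0 ∧ ∀ i < n, p (i + 1) =
        if ω (p i) (visits p i (p i)) < rightProb lam p i then p i + 1 else p i - 1 := by
  constructor
  · intro h
    refine ⟨(h 0 (Nat.zero_le _)).symm, fun i hi => ?_⟩
    have hle : ∀ j ≤ i, stackWalk (urnStack lam ω) j = p j := fun j hj => h j (by omega)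
    have := stackWalk_urnStack_succ lam ω i
    rwa [visits_congr (fun j hj => hle j hj.le), rightProb_congr lam hle, h (i + 1) hi,
      h i hi.le] at this
  · rintro ⟨h0, h⟩ i
    induction i using Nat.strong_induction_on with
    | _ i ih =>
      intro hi
      cases i with
      | zero => exact h0.symm
      | succ i =>
        have hle : ∀ j ≤ i, stackWalk (urnStack lam ω) j = p j :=
          fun j hj => ih j (by omega) (by omega)
        rw [stackWalk_urnStack_succ, visits_congr (fun j hj => hle j hj.le),
          rightProb_congr lam hle, hle i le_rfl, h i hi]

theorem tsawStep_eq_rightProb {lam : ℝ} (hl : 0 < lam) {p : ℕ → ℤ} (h0 : p 0 = 0) (n : ℕ)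
    (h : ∀ i < n, p (i + 1) = p i + 1 ∨ p (i + 1) = p i - 1) :
    tsawStep lam p n =
      if p (n + 1) = p n + 1 then rightProb lam p n
      else if p (n + 1) = p n - 1 then 1 - rightProb lam p n else 0 := by
  have f1 := edgePlus_sub_edgeMinus p h0 n h (p n)
  have f2 := edgePlus_sub_edgeMinus p h0 n h (p n - 1)
  rw [sub_add_cancel] at f2
  have key : ∀ a b : ℕ, lam ^ a / (lam ^ a + lam ^ b) =
      lam ^ ((a : ℤ) - b) / (1 + lam ^ ((a : ℤ) - b)) := by
    intro a b
    rw [zpow_sub₀ hl.ne', zpow_natCast, zpow_natCast]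
    have : lam ^ b ≠ 0 := by positivity
    field_simp
    rw [add_comm]
  have hr : lam ^ (edgePlus p n (p n) + edgeMinus p n (p n + 1)) /
      (lam ^ (edgePlus p n (p n) + edgeMinus p n (p n + 1)) +
        lam ^ (edgePlus p n (p n - 1) + edgeMinus p n (p n))) = rightProb lam p n := by
    have hE : ((edgePlus p n (p n) + edgeMinus p n (p n + 1) : ℕ) : ℤ) -
        (edgePlus p n (p n - 1) + edgeMinus p n (p n) : ℕ) =
        2 * (siteStart (p n) + edgePlus p n (p n) - edgeMinus p n (p n)) -
          if p n = 0 then 0 else 1 := by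
      unfold siteStart
      push_cast
      split_ifs at f1 f2 ⊢ <;> omega
    rw [key, hE, rightProb, sitePr]
    split_ifs
    · rw [sub_zero, tildeUp]
    · rw [urnUp]
  have hl' : lam ^ (edgePlus p n (p n - 1) + edgeMinus p n (p n)) /
      (lam ^ (edgePlus p n (p n) + edgeMinus p n (p n + 1)) +
        lam ^ (edgePlus p n (p n - 1) + edgeMinus p n (p n))) = 1 - rightProb lam p n := by
    rw [← hr]
    field_simp
    ring
  unfold tsawStep
  rw [hr, hl']

/-- The walk driven by the stacks has the law of the TSAW. -/
theorem map_stackWalk {lam : ℝ} (hl : 0 < lam) {P : Measure (ℕ → ℤ)} (hP : IsTSAW lam P) :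
    stackMeasure.map (fun ω => stackWalk (urnStack lam ω)) = P := by
  have hm : Measurable fun ω => stackWalk (urnStack lam ω) :=
    measurable_stackWalk.comp (measurable_urnStack lam)
  have := Measure.isProbabilityMeasure_map (μ := stackMeasure) hm.aemeasurable
  have := hP.1
  refine measure_ext_of_cylinder fun n p => ?_
  rw [← ENNReal.toReal_eq_toReal_iff' (measure_ne_top _ _) (measure_ne_top _ _), hP.2]
  have hc : MeasurableSet {ω : ℕ → ℤ | ∀ i ≤ n, ω i = p i} := by
    simp only [Set.ofPred_forall]
    exact MeasurableSet.iInter fun i => MeasurableSet.iInter fun _ =>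
      measurableSet_eq_fun (measurable_pi_apply i) measurable_const
  rw [Measure.map_apply hm hc]
  simp only [Set.preimage_ofPred_eq, stackWalk_forall_eq_iff]
  by_cases hp : p 0 = 0
  · simp only [hp, true_and, if_true, one_mul]
    rw [stackMeasure_steps n (fun i => (p i, visits p i (p i))) _ (rightProb lam p)
      (fun i => (sitePr_pos hl _ _).le) (fun i => (sitePr_lt_one hl _ _).le) p]
    · by_cases hn : ∀ i < n, p (i + 1) = p i + 1 ∨ p (i + 1) = p i - 1
      · exact Finset.prod_congr rfl fun i hi => (tsawStep_eq_rightProb hl hp i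
          fun j hj => hn j (hj.trans (Finset.mem_range.1 hi))).symm
      · push Not at hn
        obtain ⟨i, hi, h1, h2⟩ := hn
        rw [Finset.prod_eq_zero (Finset.mem_range.2 hi) (by rw [if_neg h1, if_neg h2]),
          Finset.prod_eq_zero (Finset.mem_range.2 hi) (by rw [tsawStep, if_neg h1, if_neg h2])]
    · have hlt : ∀ i j, i < j → p i = p j → visits p i (p i) < visits p j (p j) := by
        intro i j hij he
        have h1 : visits p (i + 1) (p i) = visits p i (p i) + 1 := by
          rw [visits_succ, if_pos rfl]
        have h2 : visits p (i + 1) (p i) ≤ visits p j (p i) := Nat.count_monotone _ hij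
        rw [← he]; omega
      intro i _ j _ he
      obtain ⟨e1, e2⟩ := Prod.mk.inj he
      rcases lt_trichotomy i j with h | h | h
      · exact absurd e2 (hlt i j h e1).ne
      · exact h
      · exact absurd e2.symm (hlt j i h e1.symm).ne
  · simp [hp]

theorem measurePreserving_eval_siteMeasure (i : ℕ) :
    MeasurePreserving (fun u : ℕ → ℝ => u i) siteMeasure unif :=
  measurePreserving_eval_infinitePi (fun _ => unif) i

theorem measurePreserving_eval_stackMeasure (k : ℤ) :
    MeasurePreserving (fun ω : ℤ → ℕ → ℝ => ω k) stackMeasure siteMeasure :=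
  measurePreserving_eval_infinitePi (fun _ => siteMeasure) k

theorem ae_exists_notMem {I : Set ℝ} (hI : MeasurableSet I) (h : unif I ≤ 2⁻¹) :
    ∀ᵐ u ∂siteMeasure, ∀ N, ∃ i ≥ N, u i ∉ I := by
  rw [ae_all_iff]
  intro N
  rw [ae_iff]
  push Not
  refine le_antisymm (ge_of_tendsto' (ENNReal.tendsto_pow_atTop_nhds_zero_of_lt_one
    (r := 2⁻¹) (by simp)) fun m => ?_) bot_le
  calc siteMeasure {u | ∀ i ≥ N, u i ∈ I}
      ≤ siteMeasure (Set.pi (Finset.Ico N (N + m)) fun _ => I) :=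
        measure_mono fun u hu i hi => hu i (Finset.mem_Ico.1 hi).1
    _ = ∏ _i ∈ Finset.Ico N (N + m), unif I :=
        Measure.infinitePi_pi _ fun _ _ => hI
    _ ≤ 2⁻¹ ^ m := by
        rw [Finset.prod_const, Nat.card_Ico, Nat.add_sub_cancel_left]
        gcongr

theorem urnPath_of_bits_false {pr : ℤ → ℝ} {d : ℤ} {u : ℕ → ℝ} {N : ℕ}
    (h : ∀ i ≥ N, urnBit pr d u i = false) (i : ℕ) :
    urnPath pr d u (N + i) = urnPath pr d u N - i := by
  induction i with
  | zero => simp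
  | succ i ih =>
    have := h (N + i) (by omega)
    rw [urnBit, decide_eq_false_iff_not] at this
    rw [← add_assoc, urnPath, if_neg this, ih]
    push_cast; ring

theorem urnPath_of_bits_true {pr : ℤ → ℝ} {d : ℤ} {u : ℕ → ℝ} {N : ℕ}
    (h : ∀ i ≥ N, urnBit pr d u i = true) (i : ℕ) :
    urnPath pr d u (N + i) = urnPath pr d u N + i := by
  induction i with
  | zero => simp
  | succ i ih =>
    have := h (N + i) (by omega)
    rw [urnBit, decide_eq_true_eq] at this
    rw [← add_assoc, urnPath, if_pos this, ih]
    push_cast; ring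

theorem exists_bound_of_finite {p : ℕ → Prop} (h : {i | p i}.Finite) : ∃ N, ∀ i ≥ N, ¬p i := by
  obtain ⟨N, hN⟩ := h.bddAbove
  exact ⟨N + 1, fun i hi hp => by have := hN hp; omega⟩

/-- Almost surely both kinds of steps occur infinitely often. -/
theorem ae_infinite_urnBit {pr : ℤ → ℝ} (hlo : ∀ w ≤ 0, 1 / 2 ≤ pr w)
    (hhi : ∀ w ≥ 1, pr w ≤ 1 / 2) (d : ℤ) :
    ∀ᵐ u ∂siteMeasure, ∀ b, {i | urnBit pr d u i = b}.Infinite := by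
  have hhalf : unif {u | u < 1 / 2} ≤ 2⁻¹ := by
    rw [unif_lt (by norm_num), one_div, ENNReal.ofReal_inv_of_pos two_pos]
    norm_num
  have hhalf' : unif {u | ¬u < 1 / 2} ≤ 2⁻¹ := by
    rw [unif_not_lt (by norm_num) (by norm_num), sub_half, one_div,
      ENNReal.ofReal_inv_of_pos two_pos]
    norm_num
  have hm : MeasurableSet {u : ℝ | u < 1 / 2} := measurableSet_Iio
  filter_upwards [ae_exists_notMem hm hhalf, ae_exists_notMem hm.compl hhalf'] with u h1 h2
  rintro (_ | _) hfin
  · obtain ⟨N, hN⟩ := exists_bound_of_finite hfin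
    have hN' : ∀ i ≥ N, urnBit pr d u i = true := fun i hi => by simpa using hN i hi
    obtain ⟨i, hi, hu⟩ := h1 (N + (1 - urnPath pr d u N).toNat)
    obtain ⟨j, rfl⟩ := Nat.exists_eq_add_of_le ((Nat.le_add_right _ _).trans hi)
    have hp := urnPath_of_bits_true hN' j
    have hb := hN' (N + j) (by omega)
    rw [urnBit, decide_eq_true_eq] at hb
    exact hu (hb.trans_le (hhi _ (by omega)))
  · obtain ⟨N, hN⟩ := exists_bound_of_finite hfin
    have hN' : ∀ i ≥ N, urnBit pr d u i = false := fun i hi => by simpa using hN i hi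
    obtain ⟨i, hi, hu⟩ := h2 (N + (urnPath pr d u N).toNat)
    obtain ⟨j, rfl⟩ := Nat.exists_eq_add_of_le ((Nat.le_add_right _ _).trans hi)
    have hp := urnPath_of_bits_false hN' j
    have hb := hN' (N + j) (by omega)
    rw [urnBit, decide_eq_false_iff_not] at hb
    exact hu fun h => hb (lt_of_lt_of_le h (hlo _ (by omega)))

theorem ae_goodStacks {lam : ℝ} (h0 : 0 < lam) (h1 : lam < 1) :
    ∀ᵐ ω ∂stackMeasure, GoodStacks (urnStack lam ω) :=
  ae_all_iff.2 fun k => (measurePreserving_eval_stackMeasure k).quasiMeasurePreserving.ae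
    (ae_infinite_urnBit (half_le_sitePr h0 h1 k) (sitePr_le_half h0 h1 k) (siteStart k))

theorem urnPath_congr (pr : ℤ → ℝ) (d : ℤ) {u v : ℕ → ℝ} (t : ℕ) (h : ∀ i < t, u i = v i) :
    urnPath pr d u t = urnPath pr d v t := by
  induction t with
  | zero => rfl
  | succ t ih => rw [urnPath, urnPath, ih fun i hi => h i (by omega), h t (by omega)]

theorem siteMeasure_path_inter (pr : ℤ → ℝ) (d : ℤ) (t : ℕ) (y : ℤ) {I : Set ℝ}
    (hI : MeasurableSet I) :
    siteMeasure {u | urnPath pr d u t = y ∧ u t ∈ I} =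
      siteMeasure {u | urnPath pr d u t = y} * unif I := by
  have h := indepFun_eval_of_dependsOn unif (Finset.range t) (i := t) (by simp)
    (measurable_urnPath pr d t) fun u v huv => urnPath_congr pr d t fun i hi =>
      huv i (by simpa using hi)
  have h' := h.measure_inter_preimage_eq_mul {y} I (measurableSet_singleton y) hI
  refine h'.trans ?_
  rw [← (measurePreserving_eval_siteMeasure t).measure_preimage hI.nullMeasurableSet]
  rfl

/-- The transition probabilities of the path are given by `chainLaw`. -/
theorem siteMeasure_urnPath {pr : ℤ → ℝ} (h0 : ∀ w, 0 ≤ pr w) (h1 : ∀ w, pr w ≤ 1) (d : ℤ)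
    (t : ℕ) (y : ℤ) :
    (siteMeasure {u | urnPath pr d u t = y}).toReal = chainLaw pr t d y := by
  induction t generalizing y with
  | zero =>
    by_cases h : d = y <;> simp [urnPath, chainLaw, h]
  | succ t ih =>
    have hm : ∀ c : ℝ, MeasurableSet {u : ℝ | u < c} := fun c => measurableSet_Iio
    have hm' : ∀ c : ℝ, MeasurableSet {u : ℝ | ¬u < c} := fun c => (hm c).compl
    have hset : {u | urnPath pr d u (t + 1) = y} =
        {u | urnPath pr d u t = y - 1 ∧ u t ∈ {x | x < pr (y - 1)}} ∪
          {u | urnPath pr d u t = y + 1 ∧ u t ∈ {x | ¬x < pr (y + 1)}} := by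
      ext u
      simp only [urnPath, Set.mem_ofPred_eq, Set.mem_union]
      constructor
      · intro h
        split_ifs at h with hu
        · obtain rfl : y = urnPath pr d u t + 1 := h.symm
          left; simpa using hu
        · obtain rfl : y = urnPath pr d u t - 1 := h.symm
          right; simpa using hu
      · rintro (⟨h, hu⟩ | ⟨h, hu⟩)
        · rw [h, if_pos hu]; ring
        · rw [h, if_neg hu]; ring
    rw [hset, measure_union, siteMeasure_path_inter pr d t _ (hm _),
      siteMeasure_path_inter pr d t _ (hm' _), unif_lt (h1 _), unif_not_lt (h0 _) (h1 _)]
    · rw [ENNReal.toReal_add (by finiteness) (by finiteness), ENNReal.toReal_mul,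
        ENNReal.toReal_mul, ih, ih, ENNReal.toReal_ofReal (h0 _),
        ENNReal.toReal_ofReal (sub_nonneg.2 (h1 _)), chainLaw_succ']
      ring
    · rw [Set.disjoint_left]
      rintro u ⟨h, -⟩ ⟨h', -⟩
      omega
    · have hu : MeasurableSet ((fun u : ℕ → ℝ => u t) ⁻¹' {x | ¬x < pr (y + 1)}) :=
        measurable_pi_apply t (hm' _)
      exact (measurable_urnPath pr d t (measurableSet_singleton _)).inter hu

theorem leftsBefore_urnBit_eq_iff {pr : ℤ → ℝ} {d : ℤ} {u : ℕ → ℝ}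
    (h : {i | urnBit pr d u i = true}.Infinite) (n a : ℕ) :
    leftsBefore (urnBit pr d u) n = a ↔
      urnPath pr d u (n + a) = d + n - a ∧ u (n + a) ∈ {x | x < pr (d + n - a)} := by
  have hcount : urnPath pr d u (n + a) = d + n - a ↔
      Nat.count (fun i => urnBit pr d u i = true) (n + a) = n := by
    rw [urnPath_eq]; push_cast; omega
  have hbit : (urnPath pr d u (n + a) = d + n - a ∧ u (n + a) ∈ {x | x < pr (d + n - a)}) ↔
      urnPath pr d u (n + a) = d + n - a ∧ urnBit pr d u (n + a) = true := by
    refine and_congr_right fun he => ?_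
    rw [urnBit, he, decide_eq_true_eq]; rfl
  have hle : n ≤ Nat.nth (fun i => urnBit pr d u i = true) n :=
    Nat.le_nth fun hf => absurd hf h
  rw [hbit, hcount, leftsBefore]
  constructor
  · intro ha
    have hn : Nat.nth (fun i => urnBit pr d u i = true) n = n + a := by omega
    rw [← hn]
    exact ⟨Nat.count_nth_of_infinite h n, Nat.nth_mem_of_infinite h n⟩
  · rintro ⟨hc, hb⟩
    have := Nat.nth_count (p := fun i => urnBit pr d u i = true) hb
    rw [hc] at this
    omega

/-- The law of the number of left instructions before the `(n+1)`-th right instruction. -/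
theorem siteMeasure_leftsBefore {pr : ℤ → ℝ} (h0 : ∀ w, 0 ≤ pr w) (h1 : ∀ w, pr w ≤ 1)
    (hlo : ∀ w ≤ 0, 1 / 2 ≤ pr w) (hhi : ∀ w ≥ 1, pr w ≤ 1 / 2) (d : ℤ) (n a : ℕ) :
    (siteMeasure {u | leftsBefore (urnBit pr d u) n = a}).toReal = leftsLaw pr (n + 1) a d := by
  have hae : siteMeasure {u | leftsBefore (urnBit pr d u) n = a} =
      siteMeasure {u | urnPath pr d u (n + a) = d + n - a ∧
        u (n + a) ∈ {x | x < pr (d + n - a)}} := by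
    refine measure_congr ?_
    filter_upwards [ae_infinite_urnBit hlo hhi d] with u hu
    exact propext (leftsBefore_urnBit_eq_iff (hu true) n a)
  have hm : MeasurableSet {x : ℝ | x < pr (d + n - a)} := measurableSet_Iio
  rw [hae, siteMeasure_path_inter pr d _ _ hm, unif_lt (h1 _), ENNReal.toReal_mul,
    siteMeasure_urnPath h0 h1, leftsLaw_eq_chainLaw,
    ENNReal.toReal_ofReal (h0 _)]

theorem measurable_nat_sInf {Ω : Type*} [MeasurableSpace Ω] {A : ℕ → Set Ω}
    (hA : ∀ x, MeasurableSet (A x)) : Measurable fun ω => sInf {x | ω ∈ A x} := by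
  refine measurable_to_countable' fun m => ?_
  have hset : (fun ω => sInf {x | ω ∈ A x}) ⁻¹' {m} =
      (A m ∩ ⋂ x, ⋂ (_ : x < m), (A x)ᶜ) ∪ ({_ω | m = 0} ∩ ⋂ x, (A x)ᶜ) := by
    ext ω
    simp only [Set.mem_preimage, Set.mem_singleton_iff, Set.mem_union, Set.mem_inter_iff,
      Set.mem_iInter, Set.mem_compl_iff, Set.mem_ofPred_eq]
    constructor
    · rintro rfl
      by_cases hne : {x | ω ∈ A x}.Nonempty
      · exact Or.inl ⟨Nat.sInf_mem hne, fun x hx => Nat.notMem_of_lt_sInf hx⟩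
      · rw [Set.not_nonempty_iff_eq_empty] at hne
        refine Or.inr ⟨by rw [hne, Nat.sInf_empty], fun x hx => ?_⟩
        have : x ∈ {x | ω ∈ A x} := hx
        rw [hne] at this
        exact this
    · rintro (⟨hm, hlt⟩ | ⟨rfl, h⟩)
      · refine le_antisymm (Nat.sInf_le hm) (not_lt.1 fun hlt' => ?_)
        have hne : {x | ω ∈ A x}.Nonempty := ⟨m, hm⟩
        exact hlt _ hlt' (Nat.sInf_mem hne)
      · rw [Nat.sInf_eq_zero]
        exact Or.inr (Set.eq_empty_iff_forall_notMem.2 h)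
  rw [hset]
  exact ((hA m).inter (MeasurableSet.iInter fun x => MeasurableSet.iInter fun _ =>
    (hA x).compl)).union
      ((MeasurableSet.const _).inter (MeasurableSet.iInter fun x => (hA x).compl))

theorem measurable_leftsBefore (n : ℕ) : Measurable fun s : ℕ → Bool => leftsBefore s n := by
  suffices h : ∀ n, Measurable fun s : ℕ → Bool => Nat.nth (fun i => s i = true) n from
    (h n).sub_const n
  intro n
  induction n using Nat.strong_induction_on with
  | _ n ih =>
    simp_rw [Nat.nth_eq_sInf _ n]
    refine measurable_nat_sInf (A := fun x => {s : ℕ → Bool | s x = true ∧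
      ∀ k < n, Nat.nth (fun i => s i = true) k < x}) fun x => ?_
    have hx : MeasurableSet ((fun s : ℕ → Bool => s x) ⁻¹' {true}) :=
      measurable_pi_apply x (measurableSet_singleton true)
    refine hx.inter ?_
    have : {s : ℕ → Bool | ∀ k < n, Nat.nth (fun i => s i = true) k < x} =
        ⋂ k, ⋂ (_ : k < n), {s | Nat.nth (fun i => s i = true) k < x} := by
      ext s; simp
    change MeasurableSet {s : ℕ → Bool | ∀ k < n, Nat.nth (fun i => s i = true) k < x}
    rw [this]
    exact MeasurableSet.iInter fun k => MeasurableSet.iInter fun hk =>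
      measurableSet_lt (ih k hk) measurable_const

theorem measurable_leftsBefore_prod :
    Measurable fun q : (ℕ → Bool) × ℕ => leftsBefore q.1 q.2 :=
  measurable_from_prod_countable_left measurable_leftsBefore

theorem measurable_leftsProfile (K j : ℕ) :
    Measurable fun S : ℤ → ℕ → Bool => leftsProfile S K j := by
  induction j with
  | zero => exact measurable_const
  | succ j ih =>
    exact measurable_leftsBefore_prod.comp ((measurable_pi_apply ((K : ℤ) - 1 - j)).prodMk ih)

theorem leftsProfile_congr {S S' : ℤ → ℕ → Bool} (K j : ℕ)
    (h : ∀ i < j, S (K - 1 - i) = S' (K - 1 - i)) : leftsProfile S K j = leftsProfile S' K j := by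
  induction j with
  | zero => rfl
  | succ j ih => rw [leftsProfile, leftsProfile, ih fun i hi => h i (by omega), h j (by omega)]

/-- The transition operator of the chain of left-step numbers along the positive sites. -/
def leftsOp (lam : ℝ) (F : ℕ → ℝ) (n : ℕ) : ℝ :=
  ∑' a : ℕ, leftsLaw (urnUp lam) (n + 1) a 0 * F a

theorem integral_leftsBefore {lam : ℝ} (h0 : 0 < lam) (h1 : lam < 1) {F : ℕ → ℝ} {C : ℝ}
    (hF : ∀ n, |F n| ≤ C) (n : ℕ) :
    ∫ u, F (leftsBefore (urnBit (urnUp lam) 0 u) n) ∂siteMeasure = leftsOp lam F n := by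
  have hm : Measurable fun u => leftsBefore (urnBit (urnUp lam) 0 u) n :=
    (measurable_leftsBefore n).comp (measurable_urnBit _ _)
  have := Measure.isProbabilityMeasure_map (μ := siteMeasure) hm.aemeasurable
  have hFm : AEStronglyMeasurable F
      (siteMeasure.map fun u => leftsBefore (urnBit (urnUp lam) 0 u) n) :=
    Measurable.of_discrete.aestronglyMeasurable
  rw [← integral_map (f := F) hm.aemeasurable hFm,
    integral_countable (Integrable.of_bound hFm C (Filter.Eventually.of_forall hF)), leftsOp]
  refine tsum_congr fun a => ?_
  rw [Measure.real, Measure.map_apply hm (measurableSet_singleton a), smul_eq_mul]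
  congr 1
  exact siteMeasure_leftsBefore (fun w => (urnUp_pos h0 w).le) (fun w => (urnUp_lt_one h0 w).le)
    (half_le_urnUp h0 h1) (urnUp_le_half h0 h1) 0 n a

theorem abs_leftsOp_le {lam : ℝ} (h0 : 0 < lam) (h1 : lam < 1) {F : ℕ → ℝ} {C : ℝ}
    (hF : ∀ n, |F n| ≤ C) (n : ℕ) : |leftsOp lam F n| ≤ C := by
  rw [← integral_leftsBefore h0 h1 hF]
  have hb : ∀ᵐ u ∂siteMeasure, ‖F (leftsBefore (urnBit (urnUp lam) 0 u) n)‖ ≤ C :=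
    Filter.Eventually.of_forall fun u => hF _
  simpa using norm_integral_le_of_norm_le_const hb

theorem integral_leftsProfile_succ {lam : ℝ} (h0 : 0 < lam) (h1 : lam < 1) {F : ℕ → ℝ} {C : ℝ}
    (hF : ∀ n, |F n| ≤ C) (K j : ℕ) (hj : j + 2 ≤ K) :
    ∫ ω, F (leftsProfile (urnStack lam ω) K (j + 1)) ∂stackMeasure =
      ∫ ω, leftsOp lam F (leftsProfile (urnStack lam ω) K j) ∂stackMeasure := by
  set k : ℤ := K - 1 - j with hk
  have hpr : sitePr lam k = urnUp lam := if_neg (by omega)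
  have hst : siteStart k = 0 := if_neg (by omega)
  have hY : Measurable fun ω => leftsProfile (urnStack lam ω) K j :=
    (measurable_leftsProfile K j).comp (measurable_urnStack lam)
  have hk' : Measurable fun ω : ℤ → ℕ → ℝ => ω k := measurable_pi_apply k
  have hind : ProbabilityTheory.IndepFun (fun ω => leftsProfile (urnStack lam ω) K j)
      (fun ω => ω k) stackMeasure := by
    refine indepFun_eval_of_dependsOn siteMeasure
      ((Finset.range j).image fun i : ℕ => (K : ℤ) - 1 - i) ?_ hY fun ω ω' h => ?_
    · simp only [Finset.mem_image, Finset.mem_range, not_exists, not_and]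
      intro i hi; omega
    · refine leftsProfile_congr K j fun i hi => ?_
      unfold urnStack
      rw [h _ (Finset.mem_coe.2 (Finset.mem_image_of_mem _ (Finset.mem_range.2 hi)))]
  have hprod := (ProbabilityTheory.indepFun_iff_map_prod_eq_prod_map_map hY.aemeasurable
    hk'.aemeasurable).1 hind
  rw [(measurePreserving_eval_stackMeasure k).map_eq] at hprod
  have := Measure.isProbabilityMeasure_map (μ := stackMeasure) hY.aemeasurable
  set G : ℕ × (ℕ → ℝ) → ℝ := fun q => F (leftsBefore (urnBit (urnUp lam) 0 q.2) q.1) with hG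
  have hGm : Measurable G := (Measurable.of_discrete (f := F)).comp
    (measurable_leftsBefore_prod.comp
      (((measurable_urnBit _ _).comp measurable_snd).prodMk measurable_fst))
  calc ∫ ω, F (leftsProfile (urnStack lam ω) K (j + 1)) ∂stackMeasure
      = ∫ ω, G (leftsProfile (urnStack lam ω) K j, ω k) ∂stackMeasure := by
        refine integral_congr_ae (Filter.Eventually.of_forall fun ω => ?_)
        simp only [hG, leftsProfile, ← hk, urnStack, hpr, hst]
    _ = ∫ q, G q ∂((stackMeasure.map fun ω => leftsProfile (urnStack lam ω) K j).prod
          siteMeasure) := by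
        rw [← hprod, integral_map (hY.prodMk hk').aemeasurable hGm.aestronglyMeasurable]
    _ = ∫ n, ∫ u, G (n, u) ∂siteMeasure
          ∂(stackMeasure.map fun ω => leftsProfile (urnStack lam ω) K j) :=
        integral_prod _ (Integrable.of_bound hGm.aestronglyMeasurable C
          (Filter.Eventually.of_forall fun q => hF _))
    _ = ∫ n, leftsOp lam F n ∂(stackMeasure.map fun ω => leftsProfile (urnStack lam ω) K j) :=
        integral_congr_ae (Filter.Eventually.of_forall fun n => integral_leftsBefore h0 h1 hF n)
    _ = _ := integral_map hY.aemeasurable Measurable.of_discrete.aestronglyMeasurable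

theorem integral_leftsProfile {lam : ℝ} (h0 : 0 < lam) (h1 : lam < 1) {F : ℕ → ℝ} {C : ℝ}
    (hF : ∀ n, |F n| ≤ C) (K j : ℕ) (hj : j + 1 ≤ K) :
    ∫ ω, F (leftsProfile (urnStack lam ω) K j) ∂stackMeasure = ((leftsOp lam)^[j] F) 0 := by
  induction j generalizing F with
  | zero => simp [leftsProfile]
  | succ j ih =>
    rw [integral_leftsProfile_succ h0 h1 hF K j hj, ih (abs_leftsOp_le h0 h1 hF) (by omega),
      Function.iterate_succ_apply]

theorem integral_leftsProfile_shift {lam : ℝ} (h0 : 0 < lam) (h1 : lam < 1) {F : ℕ → ℝ} {C : ℝ}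
    (hF : ∀ n, |F n| ≤ C) (K : ℕ) :
    ∫ ω, F (leftsProfile (urnStack lam ω) (K + 2) (K + 1)) ∂stackMeasure =
      ∫ ω, leftsOp lam F (leftsProfile (urnStack lam ω) (K + 1) K) ∂stackMeasure := by
  rw [integral_leftsProfile h0 h1 hF _ _ le_rfl,
    integral_leftsProfile h0 h1 (abs_leftsOp_le h0 h1 hF) _ _ le_rfl,
    Function.iterate_succ_apply]

theorem stackMeasure_leftsProfile_bounded {lam : ℝ} (h0 : 0 < lam) (h1 : lam < 1) (L : ℕ) :
    stackMeasure {ω | ∀ K, leftsProfile (urnStack lam ω) (K + 1) K ≤ L} = 0 := by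
  set B := {ω | ∀ K, leftsProfile (urnStack lam ω) (K + 1) K ≤ L} with hB
  by_contra hne
  have hc : 0 < stackMeasure.real B := ENNReal.toReal_pos hne (measure_ne_top _ _)
  obtain ⟨C, hC, hdrift⟩ := satur_drift h0 h1
  obtain ⟨δ, hδ, hdrift⟩ := hdrift L
  set ε := δ * stackMeasure.real B with hε
  have hε0 : 0 < ε := mul_pos hδ hc
  obtain ⟨N₀, hN₀⟩ := exists_nat_ge (2 * C / ε)
  obtain ⟨N, hN, hNL, hNN⟩ : ∃ N : ℕ, 0 < N ∧ L ≤ N ∧ N₀ ≤ N :=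
    ⟨L + N₀ + 1, by omega, by omega, by omega⟩
  have hN' : (0 : ℝ) < N := by exact_mod_cast hN
  have hCN : C / N ≤ ε / 2 := by
    have h2 : 2 * C / ε ≤ N := hN₀.trans (by exact_mod_cast hNN)
    rw [div_le_iff₀ hε0] at h2
    rw [div_le_div_iff₀ hN' two_pos]
    linarith
  have hbd : ∀ n, |satur N n| ≤ N := fun n => by
    rw [abs_of_nonneg (satur_nonneg N n)]; exact satur_le N n
  have hY : ∀ K, Measurable fun ω => leftsProfile (urnStack lam ω) (K + 1) K := fun K =>
    (measurable_leftsProfile _ _).comp (measurable_urnStack lam)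
  have hint : ∀ (F : ℕ → ℝ) (D : ℝ), (∀ n, |F n| ≤ D) → ∀ K,
      Integrable (fun ω => F (leftsProfile (urnStack lam ω) (K + 1) K)) stackMeasure :=
    fun F D hF K => Integrable.of_bound
      ((Measurable.of_discrete (f := F)).comp (hY K)).aestronglyMeasurable D
      (Filter.Eventually.of_forall fun ω => hF _)
  set e : ℕ → ℝ := fun K =>
    ∫ ω, satur N (leftsProfile (urnStack lam ω) (K + 1) K) ∂stackMeasure with he
  have hstep : ∀ K, e K + ε / 2 ≤ e (K + 1) := by
    intro K
    have hind : ∀ n : ℕ, |if n ≤ L then δ else 0| ≤ δ := fun n => by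
      split_ifs
      · exact (abs_of_pos hδ).le
      · simpa using hδ.le
    have hprob : ε ≤ ∫ ω, (if leftsProfile (urnStack lam ω) (K + 1) K ≤ L then δ else 0)
        ∂stackMeasure := by
      have hm : MeasurableSet {ω | leftsProfile (urnStack lam ω) (K + 1) K ≤ L} :=
        measurableSet_le (hY K) measurable_const
      have heq : (fun ω => if leftsProfile (urnStack lam ω) (K + 1) K ≤ L then δ else 0) =
          {ω | leftsProfile (urnStack lam ω) (K + 1) K ≤ L}.indicator fun _ => δ := by
        ext ω
        simp [Set.indicator_apply]
      rw [heq, integral_indicator_const _ hm, smul_eq_mul, hε, mul_comm]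
      exact mul_le_mul_of_nonneg_right (measureReal_mono fun ω hω => hω K) hδ.le
    have i1 := hint _ _ hbd K
    have i2 := hint _ _ hind K
    have i3 := hint _ _ (abs_leftsOp_le h0 h1 hbd) K
    have hmono := integral_mono ((i1.add i2).sub (integrable_const (C / N))) i3
      fun ω => hdrift N hN hNL (leftsProfile (urnStack lam ω) (K + 1) K)
    have hlhs := integral_sub (i1.add i2) (integrable_const (μ := stackMeasure) (C / N))
    have hlhs' := integral_add i1 i2
    simp only [integral_const, probReal_univ, one_smul] at hlhs
    have hshift := integral_leftsProfile_shift h0 h1 hbd K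
    change e (K + 1) = _ at hshift
    simp only [Pi.add_apply, Pi.sub_apply] at hmono hlhs hlhs'
    change _ ≤ ∫ ω, leftsOp lam (satur N) (leftsProfile (urnStack lam ω) (K + 1) K)
      ∂stackMeasure at hmono
    rw [hlhs, hlhs', ← hshift] at hmono
    change e K + _ - _ ≤ _ at hmono
    linarith
  have hgrow : ∀ K : ℕ, K * (ε / 2) ≤ e K := by
    intro K
    induction K with
    | zero =>
      simp only [Nat.cast_zero, zero_mul]
      exact integral_nonneg fun ω => satur_nonneg _ _
    | succ K ih =>
      have := hstep K
      push_cast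
      linarith
  have hle : ∀ K, e K ≤ N := fun K => by
    have := integral_mono (hint _ _ hbd K) (integrable_const (N : ℝ)) fun ω => satur_le N _
    simpa using this
  obtain ⟨K, hK⟩ := exists_nat_gt (N / (ε / 2))
  rw [div_lt_iff₀ (by positivity)] at hK
  linarith [hgrow K, hle K]

theorem ae_not_tendsto_atTop_stackWalk {lam : ℝ} (h0 : 0 < lam) (h1 : lam < 1) :
    ∀ᵐ ω ∂stackMeasure,
      ¬Filter.Tendsto (stackWalk (urnStack lam ω)) Filter.atTop Filter.atTop := by
  have h : ∀ᵐ ω ∂stackMeasure, ∀ L,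
      ¬∀ K, leftsProfile (urnStack lam ω) (K + 1) K ≤ L := by
    rw [ae_all_iff]
    intro L
    rw [ae_iff]
    simpa only [not_not] using stackMeasure_leftsProfile_bounded h0 h1 L
  filter_upwards [h] with ω hω ht
  obtain ⟨L, hL⟩ := leftsProfile_bounded ht
  exact hω L hL

/-- The TSAW almost surely does not converge to `+∞`. -/
theorem IsTSAW.ae_not_tendsto_atTop {lam : ℝ} (h0 : 0 < lam) (h1 : lam < 1)
    {P : Measure (ℕ → ℤ)} (hP : IsTSAW lam P) :
    ∀ᵐ X ∂P, ¬Filter.Tendsto X Filter.atTop Filter.atTop := by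
  rw [← map_stackWalk h0 hP, ae_map_iff]
  · exact ae_not_tendsto_atTop_stackWalk h0 h1
  · exact (measurable_stackWalk.comp (measurable_urnStack lam)).aemeasurable
  · exact (measurableSet_tendsto Filter.atTop fun n => measurable_pi_apply n).compl

theorem edgePlus_neg (X : ℕ → ℤ) (n : ℕ) (k : ℤ) :
    edgePlus (fun i => -X i) n k = edgeMinus X n (-k) :=
  congrArg _ (Finset.filter_congr fun i _ => by dsimp only; omega)

theorem edgeMinus_neg (X : ℕ → ℤ) (n : ℕ) (k : ℤ) :
    edgeMinus (fun i => -X i) n k = edgePlus X n (-k) :=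
  congrArg _ (Finset.filter_congr fun i _ => by dsimp only; omega)

theorem tsawStep_neg (lam : ℝ) (p : ℕ → ℤ) (i : ℕ) :
    tsawStep lam (fun i => -p i) i = tsawStep lam p i := by
  unfold tsawStep
  simp only [edgePlus_neg, edgeMinus_neg, neg_neg]
  have e1 : -(-p i + 1) = p i - 1 := by ring
  have e2 : -(-p i - 1) = p i + 1 := by ring
  rw [e1, e2]
  have a1 : edgeMinus p i (p i) + edgePlus p i (p i - 1) =
    edgePlus p i (p i - 1) + edgeMinus p i (p i) := add_comm _ _
  have a2 : edgeMinus p i (p i + 1) + edgePlus p i (p i) =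
    edgePlus p i (p i) + edgeMinus p i (p i + 1) := add_comm _ _
  rw [a1, a2, add_comm (lam ^ (edgePlus p i (p i - 1) + edgeMinus p i (p i)))]
  split_ifs <;> first | rfl | omega

theorem IsTSAW.map_neg {lam : ℝ} {P : Measure (ℕ → ℤ)} (hP : IsTSAW lam P) :
    IsTSAW lam (P.map fun X i => -X i) := by
  have := hP.1
  have hm : Measurable fun (X : ℕ → ℤ) (i : ℕ) => -X i := by fun_prop
  refine ⟨Measure.isProbabilityMeasure_map hm.aemeasurable, fun n p => ?_⟩
  have hc : MeasurableSet {ω : ℕ → ℤ | ∀ i ≤ n, ω i = p i} := by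
    simp only [Set.ofPred_forall]
    exact MeasurableSet.iInter fun i => MeasurableSet.iInter fun _ =>
      measurableSet_eq_fun (measurable_pi_apply i) measurable_const
  have h := hP.2 n fun i => -p i
  simp only [tsawStep_neg, neg_eq_zero] at h
  rw [Measure.map_apply hm hc, ← h]
  simp only [Set.preimage_ofPred_eq, neg_eq_iff_eq_neg]

/-- The walk driven by the stacks almost surely visits all sites infinitely often. -/
theorem ae_infinite_visits {lam : ℝ} (h0 : 0 < lam) (h1 : lam < 1) {P : Measure (ℕ → ℤ)}
    (hP : IsTSAW lam P) :
    ∀ᵐ ω ∂stackMeasure, ∀ k, {i | stackWalk (urnStack lam ω) i = k}.Infinite := by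
  have hneg := hP.map_neg.ae_not_tendsto_atTop h0 h1
  have hm : Measurable fun (X : ℕ → ℤ) (i : ℕ) => -X i := by fun_prop
  have hneg' := ae_of_ae_map hm.aemeasurable hneg
  rw [← map_stackWalk h0 hP] at hneg'
  have hneg'' := ae_of_ae_map
    (measurable_stackWalk.comp (measurable_urnStack lam)).aemeasurable hneg'
  filter_upwards [ae_goodStacks h0 h1, ae_not_tendsto_atTop_stackWalk h0 h1, hneg'']
    with ω hg ht hb
  rcases recurrent_or_transient hg with h | h | h
  · exact h
  · exact absurd h ht
  · exact absurd (Filter.tendsto_neg_atBot_atTop.comp h) hb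

theorem measurable_visits (n : ℕ) (k : ℤ) : Measurable fun X : ℕ → ℤ => visits X n k := by
  induction n with
  | zero => exact measurable_const
  | succ n ih =>
    simp only [visits_succ]
    have : MeasurableSet {X : ℕ → ℤ | X n = k} :=
      measurableSet_eq_fun (measurable_pi_apply n) measurable_const
    exact ih.add (Measurable.ite this measurable_const measurable_const)

theorem measurable_edgePlus (n : ℕ) (k : ℤ) : Measurable fun X : ℕ → ℤ => edgePlus X n k := by
  induction n with
  | zero => exact measurable_const
  | succ n ih =>
    simp only [edgePlus_succ]
    have : MeasurableSet {X : ℕ → ℤ | X n = k ∧ X (n + 1) = k + 1} :=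
      (measurableSet_eq_fun (measurable_pi_apply n) measurable_const).inter
        (measurableSet_eq_fun (measurable_pi_apply (n + 1)) measurable_const)
    exact ih.add (Measurable.ite this measurable_const measurable_const)

theorem measurableSet_lt_locTime (n : ℕ) (k : ℤ) (m : ℕ) :
    MeasurableSet {X : ℕ → ℤ | m < locTime X n k} := by
  simp only [locTime_eq_visits]
  exact measurableSet_lt measurable_const (measurable_visits _ k)

theorem measurable_edgePlus_invLocTime (k : ℤ) (m : ℕ) :
    Measurable fun X : ℕ → ℤ => edgePlus X (invLocTime X k m) k :=
  (measurable_from_prod_countable_left (f := fun q : (ℕ → ℤ) × ℕ => edgePlus q.1 q.2 k)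
    fun n => measurable_edgePlus n k).comp
    (measurable_id.prodMk (measurable_nat_sInf fun n => measurableSet_lt_locTime n k m))

theorem IsTSAW.edgePlus_invLocTime_law {lam : ℝ} (h0 : 0 < lam) (h1 : lam < 1)
    {P : Measure (ℕ → ℤ)} (hP : IsTSAW lam P) (k : ℤ) (m j : ℕ) (Q : Measure (ℕ → ℤ))
    [IsProbabilityMeasure Q]
    (hQ : ∀ (n : ℕ) (p : ℕ → ℤ), (Q {ω | ∀ i ≤ n, ω i = p i}).toReal =
      (if p 0 = siteStart k then (1 : ℝ) else 0) * ∏ i ∈ Finset.range n,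
        if p (i + 1) = p i + 1 then sitePr lam k (p i)
        else if p (i + 1) = p i - 1 then 1 - sitePr lam k (p i) else 0) :
    P {X | edgePlus X (invLocTime X k m) k = j} = Q {ω | ω m = siteStart k + 2 * j - m} := by
  have hm : Measurable fun ω : ℤ → ℕ → ℝ => urnPath (sitePr lam k) (siteStart k) (ω k) :=
    (measurable_pi_lambda _ fun i => measurable_urnPath _ _ i).comp (measurable_pi_apply k)
  have hw : Measurable fun ω => stackWalk (urnStack lam ω) :=
    measurable_stackWalk.comp (measurable_urnStack lam)
  have hE : MeasurableSet {X : ℕ → ℤ | edgePlus X (invLocTime X k m) k = j} :=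
    measurable_edgePlus_invLocTime k m (measurableSet_singleton j)
  rw [← map_stackWalk h0 hP,
    ← map_urnPath (fun w => (sitePr_pos h0 k w).le) (fun w => (sitePr_lt_one h0 k w).le)
      (siteStart k) k Q hQ,
    Measure.map_apply hw hE,
    Measure.map_apply hm (measurableSet_eq_fun (measurable_pi_apply m) measurable_const)]
  refine measure_congr ?_
  filter_upwards [ae_infinite_visits h0 h1 hP] with ω hω
  refine propext ?_
  change edgePlus (stackWalk (urnStack lam ω)) (invLocTime (stackWalk (urnStack lam ω)) k m) k = j ↔
    urnPath (sitePr lam k) (siteStart k) (ω k) m = siteStart k + 2 * j - m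
  rw [edgePlus_invLocTime _ _ _ (hω k), urnPath_eq]
  unfold urnStack
  omega

/-- For the TSAW: the stopping times `τ_{k,m}` are almost surely finite, and the
distribution of the number `𝓔⁺_{τ_{k,m}}(k)` of right steps from `k` before time `τ_{k,m}`
is given by the urn discrepancy chains at time `m`. -/
theorem tsaw_rightSteps_distribution (lam : ℝ) (hlam : lam ∈ Set.Ioo (0 : ℝ) 1)
    (P : Measure (ℕ → ℤ)) (hP : IsTSAW lam P)
    (PD : ℤ → Measure (ℕ → ℤ)) (hPD : IsUrnChain lam PD)
    (PDt : ℤ → Measure (ℕ → ℤ)) (hPDt : IsUrnChainTilde lam PDt) :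
    ∀ (k : ℤ) (m : ℕ),
      P {ω | ∃ n : ℕ, m < locTime ω n k} = 1 ∧
      ∀ j : ℕ, j ≤ m →
        (P {ω | edgePlus ω (invLocTime ω k m) k = j}).toReal =
          if k ≤ -1 then (PD 1 {ω' | ω' m = 2 * (j : ℤ) - (m : ℤ) + 1}).toReal
          else if k = 0 then (PDt 0 {ω' | ω' m = 2 * (j : ℤ) - (m : ℤ)}).toReal
          else (PD 0 {ω' | ω' m = 2 * (j : ℤ) - (m : ℤ)}).toReal := by
  obtain ⟨h0, h1⟩ := hlam
  intro k m
  constructor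
  · have := hP.1
    have hms : MeasurableSet {X : ℕ → ℤ | ∃ n, m < locTime X n k} := by
      rw [Set.ofPred_exists]
      exact MeasurableSet.iUnion fun n => measurableSet_lt_locTime n k m
    refine (prob_compl_eq_zero_iff hms).1 ?_
    change ∀ᵐ X ∂P, ∃ n, m < locTime X n k
    have hw : Measurable fun ω => stackWalk (urnStack lam ω) :=
      measurable_stackWalk.comp (measurable_urnStack lam)
    rw [← map_stackWalk h0 hP, ae_map_iff hw.aemeasurable hms]
    filter_upwards [ae_infinite_visits h0 h1 hP] with ω hω
    exact exists_lt_locTime _ k m (hω k)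
  · intro j _
    split_ifs with hk1 hk0
    · have := hPD.1 1
      have hst : siteStart k = 1 := if_pos hk1
      have hpr : sitePr lam k = urnUp lam := if_neg (by omega)
      rw [hP.edgePlus_invLocTime_law h0 h1 k m j (PD 1) (by
        simp only [hst, hpr, one_sub_urnUp h0]; exact hPD.2 1), hst]
      have he : (1 : ℤ) + 2 * j - m = 2 * j - m + 1 := by ring
      rw [he]
    · have := hPDt.1 0
      have hst : siteStart k = 0 := if_neg hk1
      have hpr : sitePr lam k = tildeUp lam := if_pos hk0
      rw [hP.edgePlus_invLocTime_law h0 h1 k m j (PDt 0) (by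
        simp only [hst, hpr, one_sub_tildeUp h0]; exact hPDt.2 0), hst]
      simp only [zero_add]
    · have := hPD.1 0
      have hst : siteStart k = 0 := if_neg hk1
      have hpr : sitePr lam k = urnUp lam := if_neg hk0
      rw [hP.edgePlus_invLocTime_law h0 h1 k m j (PD 0) (by
        simp only [hst, hpr, one_sub_urnUp h0]; exact hPD.2 0), hst]
      simp only [zero_add]
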